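/- arXiv:math/0310350 — 5 statements merged into one kernel-verified Lean document; each statement's English description precedes it below -/
import Mathlib

section
/- For every r > 0, the function S̃_r(z) := (1/i) S_r(e^{iz}) is an odd meromorphic function on ℂ with period 2π whose set of poles is {2kπ + 2mri : k, m ∈ ℤ}, and near 0 its Laurent expansion has the form S̃_r(z) = 2/z + a z + O(z³) for some real constant a. -/
open Complex Filter Topology Asymptotics

/-- Partial symmetric sums of the annulus Schwarz kernel
`S_r(z) = lim_{N→∞} Σ_{k=-N}^{N} (e^{2kr}+z)/(e^{2kr}-z)`. -/
noncomputable def annulusSum (r : ℝ) (z : ℂ) (N : ℕ) : ℂ :=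
  ∑ k ∈ Finset.Icc (-(N : ℤ)) (N : ℤ),
    (Complex.exp (2 * (k : ℂ) * (r : ℂ)) + z) / (Complex.exp (2 * (k : ℂ) * (r : ℂ)) - z)

/-- Partial sums of the lifted kernel `S̃_r(z) = (1/i) S_r(e^{iz})`. -/
noncomputable def annulusSumTilde (r : ℝ) (z : ℂ) (N : ℕ) : ℂ :=
  (1 / Complex.I) * annulusSum r (Complex.exp (Complex.I * z)) N

/-- The set of poles `{2kπ + 2mri : k, m ∈ ℤ}` of `S̃_r`. -/
def tildePoles (r : ℝ) : Set ℂ :=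
  {z | ∃ k m : ℤ, z = 2 * (k : ℂ) * (Real.pi : ℂ) + 2 * (m : ℂ) * (r : ℂ) * Complex.I}

noncomputable def cc (r : ℝ) (k : ℤ) (z : ℂ) : ℂ :=
  (1 / Complex.I) * ((Complex.exp (2 * (k : ℂ) * (r : ℂ)) + Complex.exp (Complex.I * z)) /
    (Complex.exp (2 * (k : ℂ) * (r : ℂ)) - Complex.exp (Complex.I * z)))

noncomputable def PP (r : ℝ) (k : ℕ) (z : ℂ) : ℂ :=
  cc r ((k : ℤ) + 1) z + cc r (-((k : ℤ) + 1)) z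

noncomputable def TT (r : ℝ) (z : ℂ) : ℂ := cc r 0 z + ∑' k : ℕ, PP r k z

lemma ann_eq_sum (r : ℝ) (z : ℂ) (N : ℕ) :
    annulusSumTilde r z N = ∑ k ∈ Finset.Icc (-(N : ℤ)) (N : ℤ), cc r k z := by
  simp only [annulusSumTilde, annulusSum, cc, Finset.mul_sum]

lemma ann_eq (r : ℝ) (z : ℂ) (N : ℕ) :
    annulusSumTilde r z N = cc r 0 z + ∑ k ∈ Finset.range N, PP r k z := by
  rw [ann_eq_sum]
  induction N with
  | zero => simp
  | succ n ih =>
    rw [Finset.sum_range_succ, ← add_assoc, ← ih]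
    have h : Finset.Icc (-((n + 1 : ℕ) : ℤ)) ((n + 1 : ℕ) : ℤ) =
        insert ((n : ℤ) + 1) (insert (-((n : ℤ) + 1)) (Finset.Icc (-(n : ℤ)) (n : ℤ))) := by
      ext x
      simp only [Finset.mem_Icc, Finset.mem_insert]
      push_cast
      omega
    rw [h, Finset.sum_insert, Finset.sum_insert, PP]
    · ring
    · simp
    · simp only [Finset.mem_Icc, Finset.mem_insert]
      omega

lemma exp_neg_k (r : ℝ) (k : ℤ) : Complex.exp (2 * ((-k : ℤ) : ℂ) * (r : ℂ)) =
    (Complex.exp (2 * (k : ℂ) * (r : ℂ)))⁻¹ := by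
  rw [← Complex.exp_neg]; congr 1; push_cast; ring

lemma cc_neg (r : ℝ) (k : ℤ) (z : ℂ) : cc r k (-z) = - cc r (-k) z := by
  unfold cc
  rw [exp_neg_k, mul_neg, Complex.exp_neg]
  set E := Complex.exp (2 * (k : ℂ) * (r : ℂ)) with hE
  set w := Complex.exp (Complex.I * z) with hw
  have hE0 : E ≠ 0 := Complex.exp_ne_zero _
  have hw0 : w ≠ 0 := Complex.exp_ne_zero _
  have h1 : E + w⁻¹ = (E / w) * (E⁻¹ + w) := by field_simp; ring
  have h2 : E - w⁻¹ = (E / w) * (-(E⁻¹ - w)) := by field_simp; ring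
  rw [h1, h2, mul_div_mul_left _ _ (div_ne_zero hE0 hw0), div_neg]
  ring

lemma cc_conj (r : ℝ) (k : ℤ) (z : ℂ) :
    cc r k ((starRingEnd ℂ) z) = (starRingEnd ℂ) (cc r (-k) z) := by
  have h : cc r (-k) z = - cc r k (-z) := by rw [cc_neg]; simp
  rw [h]
  unfold cc
  simp only [map_neg, map_mul, map_div₀, map_add, map_sub, ← Complex.exp_conj, map_one,
    Complex.conj_I, Complex.conj_ofReal, map_ofNat, map_intCast, mul_neg, div_neg, neg_mul, neg_neg]

lemma cc_per (r : ℝ) (k : ℤ) (z : ℂ) : cc r k (z + 2 * (Real.pi : ℂ)) = cc r k z := by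
  unfold cc
  have : Complex.exp (Complex.I * (z + 2 * (Real.pi : ℂ))) = Complex.exp (Complex.I * z) := by
    rw [mul_add, Complex.exp_add, show Complex.I * (2 * (Real.pi : ℂ)) = 2 * Real.pi * Complex.I by ring,
      Complex.exp_two_pi_mul_I, mul_one]
  rw [this]

lemma PP_neg (r : ℝ) (k : ℕ) (z : ℂ) : PP r k (-z) = - PP r k z := by
  unfold PP; rw [cc_neg, cc_neg, neg_neg]; ring

lemma PP_conj (r : ℝ) (k : ℕ) (z : ℂ) :
    PP r k ((starRingEnd ℂ) z) = (starRingEnd ℂ) (PP r k z) := by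
  unfold PP; rw [cc_conj, cc_conj, neg_neg, map_add]; ring

lemma TT_neg (r : ℝ) (z : ℂ) : TT r (-z) = - TT r z := by
  unfold TT
  simp only [PP_neg, tsum_neg, cc_neg, neg_zero]; ring

lemma TT_conj (r : ℝ) (z : ℂ) : TT r ((starRingEnd ℂ) z) = (starRingEnd ℂ) (TT r z) := by
  unfold TT
  simp only [PP_conj, cc_conj, neg_zero, map_add, Complex.conj_tsum]

lemma TT_per (r : ℝ) (z : ℂ) : TT r (z + 2 * (Real.pi : ℂ)) = TT r z := by
  unfold TT PP
  simp only [cc_per]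

lemma mem_poles (r : ℝ) (z : ℂ) : z ∈ tildePoles r ↔
    ∃ k : ℤ, Complex.exp (2 * (k : ℂ) * (r : ℂ)) - Complex.exp (Complex.I * z) = 0 := by
  simp only [sub_eq_zero, Complex.exp_eq_exp_iff_exists_int, tildePoles, Set.mem_ofPred_eq]
  constructor
  · rintro ⟨k, m, rfl⟩
    refine ⟨-m, -k, ?_⟩
    push_cast
    linear_combination (-2 * (m : ℂ) * r) * Complex.I_sq
  · rintro ⟨m, k, h⟩
    refine ⟨-k, -m, ?_⟩
    push_cast
    linear_combination Complex.I * h + (z + 2 * k * Real.pi) * Complex.I_sq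

lemma h_bound (u x : ℂ) (h : ‖u‖ ≤ 1 / 2) : ‖u / (1 - u)‖ ≤ 2 * ‖u‖ := by
  have h1 : (1 : ℝ) / 2 ≤ ‖1 - u‖ := by
    have := norm_sub_norm_le (1 : ℂ) u
    rw [norm_one] at this; linarith
  rw [norm_div, div_le_iff₀ (by linarith)]
  nlinarith [norm_nonneg u]

lemma PP_eq (r : ℝ) (k : ℕ) (z : ℂ) (u v : ℂ)
    (hu : u = Complex.exp (-(2 * ((k : ℂ) + 1) * r) + Complex.I * z))
    (hv : v = Complex.exp (-(2 * ((k : ℂ) + 1) * r) - Complex.I * z))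
    (hu1 : 1 - u ≠ 0) (hv1 : 1 - v ≠ 0) :
    PP r k z = (1 / Complex.I) * (2 * (u / (1 - u)) - 2 * (v / (1 - v))) := by
  unfold PP cc
  rw [exp_neg_k, ← mul_add]
  push_cast
  rw [Complex.exp_add, Complex.exp_neg] at hu
  rw [Complex.exp_sub, Complex.exp_neg] at hv
  set E := Complex.exp (2 * ((k : ℂ) + 1) * (r : ℂ)) with hE
  set w := Complex.exp (Complex.I * z) with hw
  have hE0 : E ≠ 0 := Complex.exp_ne_zero _
  have hw0 : w ≠ 0 := Complex.exp_ne_zero _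
  have h1 : E - w = E * (1 - u) := by rw [hu]; field_simp
  have h2 : E⁻¹ - w = -w * (1 - v) := by rw [hv]; field_simp; ring
  have h3 : E + w = E * (1 + u) := by rw [hu]; field_simp
  have h4 : E⁻¹ + w = -w * (-(1 + v)) := by rw [hv]; field_simp; ring
  rw [h1, h2, h3, h4, mul_div_mul_left _ _ hE0, mul_div_mul_left _ _ (neg_ne_zero.2 hw0)]
  congr 1
  field_simp
  ring

lemma norm_exp_bd (r R : ℝ) (k : ℕ) (z : ℂ) (hz : ‖z‖ < R) (s : ℂ) (hs : ‖s‖ ≤ ‖z‖) :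
    ‖Complex.exp (-(2 * ((k : ℂ) + 1) * r) + s)‖ ≤ Real.exp (-(2 * r)) ^ (k + 1) * Real.exp R := by
  rw [Complex.norm_exp, ← Real.exp_nat_mul, ← Real.exp_add]
  apply Real.exp_le_exp.2
  have h1 : s.re ≤ ‖s‖ := Complex.re_le_norm s
  have h2 : (-(2 * ((k : ℂ) + 1) * r) + s).re = -(2 * ((k : ℝ) + 1) * r) + s.re := by
    have : (-(2 * ((k : ℂ) + 1) * r) + s) = ((-(2 * ((k : ℝ) + 1) * r) : ℝ) : ℂ) + s := by
      push_cast; ring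
    rw [this, Complex.add_re, Complex.ofReal_re]
  rw [h2]; push_cast
  nlinarith

lemma PP_good (r R : ℝ) (k : ℕ) (hk : Real.exp (-(2 * r)) ^ (k + 1) * Real.exp R ≤ 1 / 2) :
    DifferentiableOn ℂ (PP r k) (Metric.ball 0 R) ∧
    ∀ z ∈ Metric.ball (0 : ℂ) R, ‖PP r k z‖ ≤ 8 * (Real.exp (-(2 * r)) ^ (k + 1) * Real.exp R) := by
  have key : ∀ z ∈ Metric.ball (0 : ℂ) R, ∀ s : ℂ, ‖s‖ ≤ ‖z‖ →
      ‖Complex.exp (-(2 * ((k : ℂ) + 1) * r) + s)‖ ≤ 1 / 2 := fun z hz s hs =>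
    (norm_exp_bd r R k z (by simpa using hz) s hs).trans hk
  have ne : ∀ u : ℂ, ‖u‖ ≤ 1 / 2 → 1 - u ≠ 0 := by
    intro u hu h
    rw [sub_eq_zero] at h
    rw [← h, norm_one] at hu
    norm_num at hu
  have nI : ∀ z : ℂ, ‖Complex.I * z‖ ≤ ‖z‖ := fun z => by simp
  have nI' : ∀ z : ℂ, ‖-(Complex.I * z)‖ ≤ ‖z‖ := fun z => by simp
  have form : ∀ z ∈ Metric.ball (0 : ℂ) R, PP r k z = _ := fun z hz =>
    PP_eq r k z _ _ rfl rfl (ne _ (key z hz _ (nI z)))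
      (ne _ (by rw [sub_eq_add_neg]; exact key z hz _ (nI' z)))
  constructor
  · refine DifferentiableOn.congr ?_ form
    intro z hz
    have h1 := ne _ (key z hz _ (nI z))
    have h2 := ne _ (key z hz _ (nI' z))
    rw [← sub_eq_add_neg] at h2
    apply DifferentiableAt.differentiableWithinAt
    fun_prop (disch := assumption)
  · intro z hz
    rw [form z hz]
    have a1 := h_bound _ 0 (key z hz _ (nI z))
    have a2 := h_bound _ 0 (key z hz _ (nI' z))
    have b1 := norm_exp_bd r R k z (by simpa using hz) _ (nI z)
    have b2 := norm_exp_bd r R k z (by simpa using hz) _ (nI' z)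
    rw [← sub_eq_add_neg] at a2 b2
    rw [norm_mul, norm_div, norm_one, Complex.norm_I, div_one, one_mul]
    refine (norm_sub_le _ _).trans ?_
    rw [norm_mul, norm_mul]
    simp only [Complex.norm_ofNat]
    linarith

lemma core (r : ℝ) (hr : 0 < r) (R : ℝ) : ∃ K₀ : ℕ, ∀ K ≥ K₀, ∃ A : ℂ → ℂ,
    DifferentiableOn ℂ A (Metric.ball 0 R) ∧ ∀ z ∈ Metric.ball (0 : ℂ) R,
      Summable (fun k => PP r k z) ∧ TT r z = annulusSumTilde r z K + A z := by
  set ρ := Real.exp (-(2 * r)) with hρ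
  have hρ0 : 0 < ρ := Real.exp_pos _
  have hρ1 : ρ < 1 := Real.exp_zero ▸ Real.exp_lt_exp.2 (by linarith)
  have ht : Tendsto (fun k : ℕ => ρ ^ (k + 1) * Real.exp R) atTop (𝓝 0) := by
    have := ((tendsto_add_atTop_iff_nat 1).2
      (tendsto_pow_atTop_nhds_zero_of_lt_one hρ0.le hρ1)).mul_const (Real.exp R)
    simpa using this
  obtain ⟨K₀, hK₀⟩ := eventually_atTop.1 (ht.eventually (ge_mem_nhds (show (0 : ℝ) < 1 / 2 by norm_num)))
  refine ⟨K₀, fun K hK => ⟨fun z => ∑' k : ℕ, PP r (k + K) z, ?_, ?_⟩⟩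
  all_goals
    have hsum : Summable (fun k : ℕ => 8 * (ρ ^ (k + K + 1) * Real.exp R)) := by
      have := ((summable_nat_add_iff (f := fun k : ℕ => ρ ^ k) (K + 1)).2
        (summable_geometric_of_lt_one hρ0.le hρ1)).mul_right (Real.exp R)
      exact this.mul_left 8
    have hg : ∀ k : ℕ, _ := fun k => PP_good r R (k + K) (hK₀ (k + K) (by omega))
  · exact differentiableOn_tsum_of_summable_norm hsum (fun k => (hg k).1) Metric.isOpen_ball
      (fun k z hz => (hg k).2 z hz)
  · intro z hz
    have hs : Summable (fun k => PP r k z) :=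
      (summable_nat_add_iff K).1 (Summable.of_norm_bounded hsum (fun k => (hg k).2 z hz))
    refine ⟨hs, ?_⟩
    rw [ann_eq, TT, ← hs.sum_add_tsum_nat_add K, add_assoc]

lemma cc_analytic (r : ℝ) (k : ℤ) (z : ℂ)
    (h : Complex.exp (2 * (k : ℂ) * (r : ℂ)) - Complex.exp (Complex.I * z) ≠ 0) :
    AnalyticAt ℂ (cc r k) z := by
  unfold cc
  fun_prop (disch := assumption)

lemma cc_pole (r : ℝ) (k : ℤ) (w : ℂ)
    (h : Complex.exp (2 * (k : ℂ) * (r : ℂ)) - Complex.exp (Complex.I * w) = 0) :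
    ∃ g : ℂ → ℂ, AnalyticAt ℂ g w ∧ g w = 2 ∧ ∀ᶠ z in 𝓝[≠] w, cc r k z = g z / (z - w) := by
  set E := Complex.exp (2 * (k : ℂ) * (r : ℂ)) with hE
  have hE0 : E ≠ 0 := Complex.exp_ne_zero _
  set D : ℂ → ℂ := fun z => Complex.I * (E - Complex.exp (Complex.I * z)) with hD
  have hDa : AnalyticAt ℂ D w := by rw [hD]; fun_prop
  have hDw : D w = 0 := by simp [hD, h]
  have hDd : deriv D w = E := by
    have : HasDerivAt D (Complex.I * (0 - Complex.exp (Complex.I * w) * (Complex.I * 1))) w :=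
      ((hasDerivAt_const w E).sub (((hasDerivAt_id w).const_mul Complex.I).cexp)).const_mul _
    rw [this.deriv, ← sub_eq_zero.1 h]
    linear_combination (-E) * Complex.I_sq
  have hds : AnalyticAt ℂ (dslope D w) w := by
    obtain ⟨p, hp⟩ := hDa
    exact hp.has_fpower_series_dslope_fslope.analyticAt
  have hdw : dslope D w w = E := by rw [dslope_same, hDd]
  refine ⟨fun z => (E + Complex.exp (Complex.I * z)) / dslope D w z, ?_, ?_, ?_⟩
  · have : dslope D w w ≠ 0 := by rw [hdw]; exact hE0
    fun_prop (disch := assumption)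
  · simp only [hdw, ← sub_eq_zero.1 h]
    field_simp; ring
  · filter_upwards [self_mem_nhdsWithin] with z hz
    have hz' : z - w ≠ 0 := sub_ne_zero.2 hz
    have h1 := sub_smul_dslope D w z
    rw [hDw, sub_zero, smul_eq_mul] at h1
    rw [div_div, mul_comm (dslope D w z), h1, cc, hD, ← hE]
    rw [div_mul_div_comm, one_mul]

lemma TT_pole (r : ℝ) (hr : 0 < r) (w : ℂ) (hw : w ∈ tildePoles r) :
    ∃ g : ℂ → ℂ, AnalyticAt ℂ g w ∧ g w = 2 ∧ ∀ᶠ z in 𝓝[≠] w, TT r z = g z / (z - w) := by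
  obtain ⟨m, hm⟩ := (mem_poles r w).1 hw
  obtain ⟨K₀, hK₀⟩ := core r hr (‖w‖ + 1)
  obtain ⟨A, hA, hT⟩ := hK₀ (K₀ + m.natAbs) (by omega)
  have hball : Metric.ball (0 : ℂ) (‖w‖ + 1) ∈ 𝓝 w :=
    Metric.isOpen_ball.mem_nhds (by simp)
  have hAa : AnalyticAt ℂ A w := hA.analyticAt hball
  obtain ⟨g, hg, hgw, hge⟩ := cc_pole r m w hm
  set S := (Finset.Icc (-((K₀ + m.natAbs : ℕ) : ℤ)) ((K₀ + m.natAbs : ℕ) : ℤ)) with hS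
  have hmS : m ∈ S := by rw [hS, Finset.mem_Icc]; omega
  have hB : AnalyticAt ℂ (fun z => ∑ k ∈ S.erase m, cc r k z) w := by
    apply Finset.analyticAt_fun_sum
    intro k hk
    apply cc_analytic
    intro h
    apply Finset.ne_of_mem_erase hk
    have h2 : Complex.exp (2 * (k : ℂ) * (r : ℂ)) = Complex.exp (2 * (m : ℂ) * (r : ℂ)) := by
      rw [sub_eq_zero.1 h, sub_eq_zero.1 hm]
    have h3 : Real.exp (2 * (k : ℝ) * r) = Real.exp (2 * (m : ℝ) * r) := by
      exact_mod_cast h2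
    have h4 := Real.exp_injective h3
    have h5 : (k : ℝ) = m := by
      have := mul_right_cancel₀ hr.ne' h4
      linarith
    exact_mod_cast h5
  refine ⟨fun z => g z + (z - w) * ((∑ k ∈ S.erase m, cc r k z) + A z), by fun_prop, by simp [hgw], ?_⟩
  filter_upwards [hge, self_mem_nhdsWithin, mem_nhdsWithin_of_mem_nhds hball] with z h1 h2 h3
  have hz' : z - w ≠ 0 := sub_ne_zero.2 h2
  rw [(hT z h3).2, ann_eq_sum, ← Finset.add_sum_erase S _ hmS, h1]
  field_simp
  ring

lemma tneg0 : Tendsto (fun z : ℂ => -z) (𝓝[≠] 0) (𝓝[≠] 0) := by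
  refine tendsto_nhdsWithin_iff.2 ⟨?_, ?_⟩
  · have : Tendsto (fun z : ℂ => -z) (𝓝 0) (𝓝 (-0)) := continuous_neg.tendsto 0
    rw [neg_zero] at this
    exact this.mono_left nhdsWithin_le_nhds
  · filter_upwards [self_mem_nhdsWithin] with z hz
    simpa using hz

lemma tconj0 : Tendsto (fun z : ℂ => (starRingEnd ℂ) z) (𝓝[≠] 0) (𝓝[≠] 0) := by
  refine tendsto_nhdsWithin_iff.2 ⟨?_, ?_⟩
  · have : Tendsto (fun z : ℂ => (starRingEnd ℂ) z) (𝓝 0) (𝓝 ((starRingEnd ℂ) 0)) :=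
      Complex.continuous_conj.tendsto 0
    rw [map_zero] at this
    exact this.mono_left nhdsWithin_le_nhds
  · filter_upwards [self_mem_nhdsWithin] with z hz
    simpa using hz

lemma conj_zero (f : ℂ → ℂ) (hf : AnalyticAt ℂ f 0)
    (hc : ∀ᶠ z in 𝓝[≠] (0 : ℂ), f ((starRingEnd ℂ) z) = (starRingEnd ℂ) (f z)) :
    (starRingEnd ℂ) (f 0) = f 0 := by
  have l : Tendsto f (𝓝[≠] 0) (𝓝 (f 0)) :=
    hf.continuousAt.tendsto.mono_left nhdsWithin_le_nhds
  have l1 := l.comp tconj0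
  have l2 := (Complex.continuous_conj.tendsto (f 0)).comp l
  exact tendsto_nhds_unique (l2.congr' (hc.mono fun z hz => hz.symm)) l1

lemma odd_zero (f : ℂ → ℂ) (hf : AnalyticAt ℂ f 0)
    (hc : ∀ᶠ z in 𝓝[≠] (0 : ℂ), f (-z) = -f z) : f 0 = 0 := by
  have l : Tendsto f (𝓝[≠] 0) (𝓝 (f 0)) :=
    hf.continuousAt.tendsto.mono_left nhdsWithin_le_nhds
  have l1 := l.comp tneg0
  have := tendsto_nhds_unique (l.neg.congr' (hc.mono fun z hz => hz.symm)) l1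
  exact self_eq_neg.1 this.symm

lemma even_step (g : ℂ → ℂ) (hg : AnalyticAt ℂ g 0) (he : ∀ᶠ z in 𝓝[≠] (0 : ℂ), g (-z) = g z)
    (hc : ∀ᶠ z in 𝓝[≠] (0 : ℂ), g ((starRingEnd ℂ) z) = (starRingEnd ℂ) (g z)) :
    ∃ h : ℂ → ℂ, AnalyticAt ℂ h 0 ∧ (∀ᶠ z in 𝓝[≠] (0 : ℂ), h (-z) = h z) ∧
      (∀ᶠ z in 𝓝[≠] (0 : ℂ), h ((starRingEnd ℂ) z) = (starRingEnd ℂ) (h z)) ∧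
      ∀ z, g z = g 0 + z ^ 2 * h z := by
  have h0 := conj_zero g hg hc
  have ds : ∀ f : ℂ → ℂ, AnalyticAt ℂ f 0 → AnalyticAt ℂ (dslope f 0) 0 := by
    rintro f ⟨p, hp⟩
    exact hp.has_fpower_series_dslope_fslope.analyticAt
  have hg1 := ds g hg
  have hg2 := ds _ hg1
  set g1 := dslope g 0 with hg1d
  set h := dslope g1 0 with hhd
  have e1 : ∀ z, z * g1 z = g z - g 0 := fun z => by
    have := sub_smul_dslope g 0 z
    rwa [sub_zero, smul_eq_mul] at this
  have e2 : ∀ z, z * h z = g1 z - g1 0 := fun z => by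
    have := sub_smul_dslope g1 0 z
    rwa [sub_zero, smul_eq_mul] at this
  have ne0 : ∀ᶠ z in 𝓝[≠] (0 : ℂ), z ≠ 0 := self_mem_nhdsWithin
  have g10 : g1 0 = 0 := by
    apply odd_zero g1 hg1
    filter_upwards [he, ne0] with z h1 h2
    apply mul_left_cancel₀ h2
    linear_combination (-1 : ℂ) * e1 (-z) + e1 z - h1
  have e3 : ∀ z, g z = g 0 + z ^ 2 * h z := fun z => by
    linear_combination (-1 : ℂ) * e1 z - z * e2 z + z * g10
  refine ⟨h, hg2, ?_, ?_, e3⟩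
  · filter_upwards [he, ne0] with z h1 h2
    apply mul_left_cancel₀ (pow_ne_zero 2 h2)
    linear_combination (-1 : ℂ) * e3 (-z) + e3 z + h1
  · filter_upwards [hc, ne0] with z h1 h2
    have h3 : (starRingEnd ℂ) z ≠ 0 := by simpa using h2
    apply mul_left_cancel₀ (pow_ne_zero 2 h3)
    have e4 := congrArg (starRingEnd ℂ) (e3 z)
    simp only [map_add, map_mul, map_pow] at e4
    linear_combination (-1 : ℂ) * e3 ((starRingEnd ℂ) z) + e4 + h1 + h0

/-- For every `r > 0`, `S̃_r(z) = (1/i) S_r(e^{iz})` is an odd meromorphic function on `ℂ`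
with period `2π` whose poles are exactly the simple poles at `{2kπ + 2mri : k,m ∈ ℤ}`,
and near `0` its Laurent expansion is `S̃_r(z) = 2/z + a z + O(z³)` with `a` real. -/
theorem stmt5 (r : ℝ) (hr : 0 < r) :
    ∃ T : ℂ → ℂ,
      (∀ z : ℂ, z ∉ tildePoles r →
        Tendsto (fun N => annulusSumTilde r z N) atTop (𝓝 (T z))) ∧
      (∀ z : ℂ, z ∉ tildePoles r → T (-z) = -T z) ∧
      (∀ z : ℂ, z ∉ tildePoles r → T (z + 2 * (Real.pi : ℂ)) = T z) ∧
      (∀ z : ℂ, z ∉ tildePoles r → AnalyticAt ℂ T z) ∧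
      (∀ w ∈ tildePoles r, ∃ g : ℂ → ℂ, AnalyticAt ℂ g w ∧ g w ≠ 0 ∧
        ∀ᶠ z in 𝓝[≠] w, T z = g z / (z - w)) ∧
      (∃ a : ℝ, (fun z : ℂ => T z - 2 / z - (a : ℂ) * z) =O[𝓝[≠] (0 : ℂ)]
        fun z : ℂ => z ^ 3) := by
  refine ⟨TT r, ?_, fun z _ => TT_neg r z, fun z _ => TT_per r z, ?_, ?_, ?_⟩
  · intro z _
    obtain ⟨K₀, hK₀⟩ := core r hr (‖z‖ + 1)
    obtain ⟨A, hA, hT⟩ := hK₀ K₀ le_rfl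
    have hs := (hT z (by simp)).1
    simp only [ann_eq]
    exact hs.hasSum.tendsto_sum_nat.const_add _
  · intro z hz
    obtain ⟨K₀, hK₀⟩ := core r hr (‖z‖ + 1)
    obtain ⟨A, hA, hT⟩ := hK₀ K₀ le_rfl
    have hball : Metric.ball (0 : ℂ) (‖z‖ + 1) ∈ 𝓝 z :=
      Metric.isOpen_ball.mem_nhds (by simp)
    have hAa : AnalyticAt ℂ A z := hA.analyticAt hball
    have hB : AnalyticAt ℂ (fun x => ∑ k ∈ Finset.Icc (-(K₀ : ℤ)) (K₀ : ℤ), cc r k x) z := by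
      apply Finset.analyticAt_fun_sum
      intro k _
      exact cc_analytic r k z fun h => hz ((mem_poles r z).2 ⟨k, h⟩)
    refine (hB.add hAa).congr ?_
    filter_upwards [hball] with x hx
    rw [(hT x hx).2, ann_eq_sum]
    rfl
  · intro w hw
    obtain ⟨g, h1, h2, h3⟩ := TT_pole r hr w hw
    exact ⟨g, h1, by rw [h2]; norm_num, h3⟩
  · obtain ⟨g, hg, g0, hT⟩ := TT_pole r hr 0 ⟨0, 0, by simp⟩
    have ne0 : ∀ᶠ z in 𝓝[≠] (0 : ℂ), z ≠ 0 := self_mem_nhdsWithin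
    have hT' : ∀ᶠ z in 𝓝[≠] (0 : ℂ), g z = z * TT r z := by
      filter_upwards [hT, ne0] with z h1 h2
      rw [h1, sub_zero]; field_simp
    obtain ⟨h, hh, hhe, hhc, e1⟩ := even_step g hg
      (by
        filter_upwards [hT', tneg0.eventually hT'] with z h1 h2
        rw [h1, h2, TT_neg]; ring)
      (by
        filter_upwards [hT', tconj0.eventually hT'] with z h1 h2
        rw [h1, h2, TT_conj, map_mul])
    obtain ⟨p, hp, -, -, e2⟩ := even_step h hh hhe hhc
    have hreal := conj_zero h hh hhc
    obtain ⟨a, ha⟩ := Complex.conj_eq_iff_real.1 hreal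
    refine ⟨a, ?_⟩
    have hb : p =O[𝓝[≠] (0 : ℂ)] (fun _ => (1 : ℂ)) :=
      (hp.continuousAt.tendsto.mono_left nhdsWithin_le_nhds).isBigO_one ℂ
    have hmul := (isBigO_refl (fun z : ℂ => z ^ 3) (𝓝[≠] (0 : ℂ))).mul hb
    refine hmul.congr' ?_ (by simp)
    filter_upwards [hT, ne0] with z h1 h2
    rw [h1, e1 z, e2 z, g0, ha, sub_zero]
    field_simp
    ring
end

section
/- For every r > 0, the function S̃_r satisfies the identity ∂_r S̃_r − S̃_r · S̃_r′ − S̃_r″ ≡ 0 on its domain of analyticity, where primes denote derivatives in z. -/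
open Complex Filter Topology

noncomputable def ff (w : ℂ) : ℂ := (1 / I) * ((1 + exp (I * w)) / (1 - exp (I * w)))
noncomputable def fd (w : ℂ) : ℂ := 2 * exp (I * w) / (1 - exp (I * w)) ^ 2
noncomputable def pt (r : ℝ) (z : ℂ) (k : ℤ) : ℂ := z + 2 * (k : ℂ) * (r : ℂ) * I

lemma ff_zero : ff 0 = 0 := by simp [ff]

lemma exp_inv_I (w : ℂ) : exp (I * -w) = (exp (I * w))⁻¹ := by
  rw [mul_neg, Complex.exp_neg]

lemma ff_neg (w : ℂ) : ff (-w) = - ff w := by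
  unfold ff
  rw [exp_inv_I]
  have h0 : exp (I * w) ≠ 0 := Complex.exp_ne_zero _
  generalize exp (I * w) = x at *
  by_cases hx : x = 1
  · simp [hx]
  have h1 : 1 - x ≠ 0 := fun h => hx (by linear_combination -h)
  have h2 : x - 1 ≠ 0 := fun h => hx (by linear_combination h)
  have : 1 - x⁻¹ ≠ 0 := by
    intro h; apply hx; field_simp at h; linear_combination h
  field_simp
  ring

lemma fd_neg (w : ℂ) : fd (-w) = fd w := by
  unfold fd
  rw [exp_inv_I]
  have h0 : exp (I * w) ≠ 0 := Complex.exp_ne_zero _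
  generalize exp (I * w) = x at *
  by_cases hx : x = 1
  · simp [hx]
  have h1 : 1 - x ≠ 0 := fun h => hx (by linear_combination -h)
  have h2 : x - 1 ≠ 0 := fun h => hx (by linear_combination h)
  have : 1 - x⁻¹ ≠ 0 := by
    intro h; apply hx; field_simp at h; linear_combination h
  field_simp
  ring

lemma hasDerivAt_ff {w : ℂ} (hw : exp (I * w) ≠ 1) : HasDerivAt ff (fd w) w := by
  have h1 : (1:ℂ) - exp (I * w) ≠ 0 := fun h => hw (by linear_combination -h)
  have e : HasDerivAt (fun w : ℂ => exp (I * w)) (exp (I * w) * (I * 1)) w :=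
    ((hasDerivAt_id w).const_mul I).cexp
  have := ((e.const_add 1).div (e.const_sub 1) h1).const_mul (1 / I)
  refine this.congr_deriv ?_
  unfold fd
  have := I_ne_zero
  field_simp
  ring

lemma hasDerivAt_fd {w : ℂ} (hw : exp (I * w) ≠ 1) : HasDerivAt fd (- (ff w * fd w)) w := by
  have h1 : (1:ℂ) - exp (I * w) ≠ 0 := fun h => hw (by linear_combination -h)
  have e : HasDerivAt (fun w : ℂ => exp (I * w)) (exp (I * w) * (I * 1)) w :=
    ((hasDerivAt_id w).const_mul I).cexp
  have := ((e.const_mul 2).div ((e.const_sub 1).pow 2) (pow_ne_zero 2 h1))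
  refine this.congr_deriv ?_
  unfold fd ff
  have hI := I_ne_zero
  have hI2 := I_sq
  simp only [Pi.pow_apply]
  field_simp
  push_cast
  generalize exp (I * w) = x
  ring_nf
  simp only [hI2]
  ring

lemma addition {a b : ℂ} (ha : exp (I * a) ≠ 1) (hb : exp (I * b) ≠ 1)
    (hab : exp (I * (a - b)) ≠ 1) :
    ff a * fd b + fd a * ff b = ff (a - b) * (fd b - fd a) := by
  have e : exp (I * (a - b)) = exp (I * a) / exp (I * b) := by
    rw [mul_sub, Complex.exp_sub]
  unfold ff fd
  rw [e] at hab ⊢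
  have hx0 : exp (I * a) ≠ 0 := Complex.exp_ne_zero _
  have hy0 : exp (I * b) ≠ 0 := Complex.exp_ne_zero _
  generalize exp (I * a) = x at *
  generalize exp (I * b) = y at *
  have h1 : 1 - x ≠ 0 := fun h => ha (by linear_combination -h)
  have h2 : 1 - y ≠ 0 := fun h => hb (by linear_combination -h)
  have h4 : y - x ≠ 0 := fun h => hab (by rw [div_eq_one_iff_eq hy0]; linear_combination -h)
  have e1 : (1 + x / y) / (1 - x / y) = (y + x) / (y - x) := by
    rw [one_add_div hy0, one_sub_div hy0, div_div_div_cancel_right₀ hy0]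
  rw [e1]
  have := I_ne_zero
  field_simp
  ring

lemma exp_ne_one_of_im {w : ℂ} (h : w.im ≠ 0) : exp (I * w) ≠ 1 := by
  intro e
  have := congrArg (fun x => ‖x‖) e
  simp [Complex.norm_exp] at this
  exact h this

lemma bounds_pos {d : ℝ} (hd : 0 < d) {w : ℂ} (h : d ≤ w.im) :
    ‖ff w‖ ≤ 2 / (1 - Real.exp (-d)) ∧
    ‖fd w‖ ≤ 2 / (1 - Real.exp (-d)) ^ 2 * Real.exp (-w.im) := by
  have hD : 0 < 1 - Real.exp (-d) := by
    have : Real.exp (-d) < 1 := by rw [Real.exp_lt_one_iff]; linarith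
    linarith
  have hn : ‖exp (I * w)‖ = Real.exp (-w.im) := by simp [Complex.norm_exp]
  have hle : Real.exp (-w.im) ≤ Real.exp (-d) := Real.exp_le_exp.2 (by linarith)
  have hlow : 1 - Real.exp (-d) ≤ ‖1 - exp (I * w)‖ := by
    have := norm_sub_norm_le (1:ℂ) (exp (I * w))
    rw [hn, norm_one] at this
    linarith
  constructor
  · unfold ff
    rw [norm_mul, norm_div, norm_div, norm_one, norm_I, div_one, one_mul]
    have : ‖1 + exp (I * w)‖ ≤ 2 := by
      have := norm_add_le (1:ℂ) (exp (I * w))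
      rw [hn, norm_one] at this
      linarith
    gcongr
  · unfold fd
    rw [norm_div, norm_mul, hn, norm_pow, Complex.norm_two, mul_div_right_comm]
    gcongr

lemma bounds {d : ℝ} (hd : 0 < d) {w : ℂ} (h : d ≤ |w.im|) :
    ‖ff w‖ ≤ 2 / (1 - Real.exp (-d)) ∧
    ‖fd w‖ ≤ 2 / (1 - Real.exp (-d)) ^ 2 * Real.exp (-|w.im|) := by
  rcases le_total 0 w.im with h0 | h0
  · rw [abs_of_nonneg h0] at *
    exact bounds_pos hd h
  · rw [abs_of_nonpos h0] at *
    have := bounds_pos hd (w := -w) (by simpa using h)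
    rwa [ff_neg, fd_neg, norm_neg, neg_im] at this

lemma sum_eq (r : ℝ) (z : ℂ) (N : ℕ) :
    annulusSumTilde r z N = ∑ k ∈ Finset.Icc (-(N:ℤ)) N, ff (pt r z k) := by
  unfold annulusSumTilde annulusSum ff
  rw [Finset.mul_sum]
  refine Finset.sum_congr rfl fun k _ => ?_
  congr 1
  have : exp (I * pt r z k) = exp (I * z) / exp (2 * k * r) := by
    rw [← Complex.exp_sub]
    congr 1
    unfold pt
    linear_combination (2 * k * r : ℂ) * I_sq
  rw [this]
  have h0 : exp (2 * k * r : ℂ) ≠ 0 := Complex.exp_ne_zero _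
  rw [one_add_div h0, one_sub_div h0, div_div_div_cancel_right₀ h0]

lemma mem_poles_s6 (r : ℝ) (z : ℂ) : z ∉ tildePoles r ↔ ∀ k, exp (I * pt r z k) ≠ 1 := by
  unfold tildePoles pt
  simp only [Set.mem_ofPred_eq, not_exists, ne_eq, Complex.exp_eq_one_iff]
  constructor
  · intro h k n e
    apply h n (-k)
    have := mul_left_cancel₀ I_ne_zero (e.trans (by ring : _ = I * (n * (2 * Real.pi))))
    push_cast
    linear_combination this
  · intro h k m e
    apply h (-m) k
    rw [e]; push_cast; ring

lemma pt_im (r : ℝ) (z : ℂ) (k : ℤ) : (pt r z k).im = z.im + 2 * k * r := by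
  simp [pt]

lemma sum_shift (g : ℤ → ℂ) (N : ℕ) :
    ∑ j ∈ Finset.Icc (-(N:ℤ)) N, g (j - 1) =
      ∑ j ∈ Finset.Icc (-(N:ℤ)) N, g j + g (-N - 1) - g N := by
  induction N with
  | zero => simp
  | succ n ih =>
    have key : ∀ g : ℤ → ℂ, ∑ j ∈ Finset.Icc (-((n+1:ℕ):ℤ)) ((n+1:ℕ):ℤ), g j =
        g (n+1) + (g (-n-1) + ∑ j ∈ Finset.Icc (-(n:ℤ)) n, g j) := by
      intro g
      rw [← Finset.sum_insert, ← Finset.sum_insert]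
      · congr 1
        ext x; simp; omega
      · simp; omega
      · simp
    rw [key g, key (fun j => g (j-1)), ih]
    push_cast
    rw [show (n:ℤ)+1-1 = n by ring, show -((n:ℤ)+1) - 1 = -n-1-1 by ring]
    ring

lemma finite_identity (s : Finset ℤ) (c d h : ℤ → ℂ) (hodd : ∀ m, h (-m) = - h m)
    (H : ∀ j k, j ≠ k → c j * d k + d j * c k = h (j - k) * (d k - d j)) :
    (∑ j ∈ s, c j) * (∑ k ∈ s, d k) + ∑ k ∈ s, -(c k * d k) =
      ∑ k ∈ s, d k * ∑ j ∈ s, h (j - k) := by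
  have e1 : ∑ j ∈ s, ∑ k ∈ s, (c j * d k + d j * c k) =
      ∑ j ∈ s, ∑ k ∈ s, (h (j - k) * (d k - d j) + if j = k then 2 * (c j * d j) else 0) := by
    refine Finset.sum_congr rfl fun j _ => Finset.sum_congr rfl fun k _ => ?_
    by_cases hjk : j = k
    · subst hjk; simp; ring
    · simp [hjk, H j k hjk]
  have e2 : ∑ j ∈ s, ∑ k ∈ s, d j * c k = ∑ j ∈ s, ∑ k ∈ s, c j * d k := by
    rw [Finset.sum_comm]
    simp only [mul_comm]
  have e3 : ∑ j ∈ s, ∑ k ∈ s, h (j - k) * d j = - ∑ j ∈ s, ∑ k ∈ s, h (j - k) * d k := by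
    rw [Finset.sum_comm, ← Finset.sum_neg_distrib]
    refine Finset.sum_congr rfl fun j _ => ?_
    rw [← Finset.sum_neg_distrib]
    refine Finset.sum_congr rfl fun k _ => ?_
    rw [← neg_sub, hodd]; ring
  have e4 : ∑ j ∈ s, ∑ k ∈ s, (if j = k then 2 * (c j * d j) else 0) = 2 * ∑ k ∈ s, c k * d k := by
    rw [Finset.mul_sum]
    refine Finset.sum_congr rfl fun j hj => ?_
    simp [hj]
  have e5 : ∑ k ∈ s, d k * ∑ j ∈ s, h (j - k) = ∑ j ∈ s, ∑ k ∈ s, h (j - k) * d k := by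
    rw [Finset.sum_comm]
    refine Finset.sum_congr rfl fun j hj => ?_
    rw [Finset.mul_sum]
    simp only [mul_comm]
  simp only [Finset.sum_add_distrib, mul_sub, Finset.sum_sub_distrib] at e1
  rw [e2, e3, e4] at e1
  rw [e5, Finset.sum_mul_sum, Finset.sum_neg_distrib]
  linear_combination e1 / 2

lemma A_zero (h : ℤ → ℂ) (hodd : ∀ m, h (-m) = - h m) (N : ℕ) :
    ∑ j ∈ Finset.Icc (-(N:ℤ)) N, h (j - 0) = 0 := by
  simp only [sub_zero]
  have : ∑ j ∈ Finset.Icc (-(N:ℤ)) N, h j = ∑ j ∈ Finset.Icc (-(N:ℤ)) N, h (-j) := by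
    refine Finset.sum_equiv (Equiv.neg ℤ) ?_ ?_
    · intro i; simp; omega
    · intro i _; simp
  simp only [hodd, Finset.sum_neg_distrib] at this
  linear_combination this / 2

lemma A_step (h : ℤ → ℂ) (N : ℕ) (k : ℤ) : ∑ j ∈ Finset.Icc (-(N:ℤ)) N, h (j - (k + 1)) =
      ∑ j ∈ Finset.Icc (-(N:ℤ)) N, h (j - k) + h (-N - 1 - k) - h (N - k) := by
  rw [← sum_shift (fun j => h (j - k))]
  refine Finset.sum_congr rfl fun j _ => ?_
  congr 1; ring

lemma A_bound (h : ℤ → ℂ) (C : ℝ) (hC : ∀ m, ‖h m‖ ≤ C) (hodd : ∀ m, h (-m) = - h m) (N : ℕ)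
    (k : ℤ) : ‖∑ j ∈ Finset.Icc (-(N:ℤ)) N, h (j - k)‖ ≤ 2 * C * |(k:ℝ)| := by
  induction k using Int.induction_on with
  | zero => rw [A_zero h hodd]; simp
  | succ i ih =>
    rw [A_step]
    refine (norm_sub_le _ _).trans ?_
    have h1 := norm_add_le (∑ j ∈ Finset.Icc (-(N:ℤ)) N, h (j - i)) (h (-N - 1 - i))
    have h2 := hC (-N - 1 - i)
    have h3 := hC (N - i)
    push_cast at ih ⊢
    rw [abs_of_nonneg (by positivity)] at ih ⊢
    linarith
  | pred i ih =>
    have e := A_step h N (-i - 1)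
    rw [sub_add_cancel] at e
    have e' : ∑ j ∈ Finset.Icc (-(N:ℤ)) N, h (j - (-i - 1)) =
      ∑ j ∈ Finset.Icc (-(N:ℤ)) N, h (j - -i) - h (-N - 1 - (-i - 1)) + h (N - (-i - 1)) := by
      rw [e]; ring
    rw [e']
    refine (norm_add_le _ _).trans ?_
    have h1 := norm_sub_le (∑ j ∈ Finset.Icc (-(N:ℤ)) N, h (j - -i)) (h (-N - 1 - (-i - 1)))
    have h2 := hC (-N - 1 - (-i - 1))
    have h3 := hC (N - (-i - 1))
    have hi : (0:ℝ) ≤ i := by positivity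
    push_cast at ih ⊢
    rw [abs_of_nonpos (by linarith)] at ih ⊢
    linarith

lemma A_lim (h : ℤ → ℂ) (hodd : ∀ m, h (-m) = - h m) (ht : Tendsto h atTop (𝓝 (-I))) (k : ℤ) :
    Tendsto (fun N : ℕ => ∑ j ∈ Finset.Icc (-(N:ℤ)) N, h (j - k)) atTop (𝓝 (2 * k * I)) := by
  have l1 : ∀ k : ℤ, Tendsto (fun N : ℕ => h (N - k)) atTop (𝓝 (-I)) := fun k =>
    ht.comp ((tendsto_atTop_add_const_right _ (-k) tendsto_natCast_atTop_atTop).congr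
      fun x => (sub_eq_add_neg _ _).symm)
  have l2 : ∀ k : ℤ, Tendsto (fun N : ℕ => h (-N - 1 - k)) atTop (𝓝 I) := fun k => by
    have := (l1 (- k - 1)).neg
    rw [neg_neg] at this
    refine this.congr fun N => ?_
    rw [← hodd]; congr 1; ring
  induction k using Int.induction_on with
  | zero => simp only [A_zero h hodd]; simp
  | succ i ih =>
    simp only [A_step]
    have := (ih.add (l2 i)).sub (l1 i)
    convert this using 2
    push_cast; ring
  | pred i ih =>
    have := (ih.sub (l2 (-i-1))).add (l1 (-i-1))
    convert this using 2 with N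
    · have e := A_step h N (-i - 1)
      rw [sub_add_cancel] at e
      rw [e]; ring
    · push_cast; ring

lemma h_lim {r : ℝ} (hr : 0 < r) : Tendsto (fun m : ℤ => ff (pt r 0 m)) atTop (𝓝 (-I)) := by
  have h1 : Tendsto (fun m : ℤ => exp (I * pt r 0 m)) atTop (𝓝 0) := by
    rw [tendsto_zero_iff_norm_tendsto_zero]
    have : ∀ m : ℤ, ‖exp (I * pt r 0 m)‖ = Real.exp (-(m * (2 * r))) := by
      intro m
      rw [Complex.norm_exp]
      congr 1
      have := pt_im r 0 m
      simp [this]; ring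
    simp only [this]
    refine Real.tendsto_exp_neg_atTop_nhds_zero.comp ?_
    exact (tendsto_intCast_atTop_atTop).atTop_mul_const (by positivity)
  have := ((h1.const_add 1).div (h1.const_sub 1) (by simp)).const_mul (1 / I)
  have e : (1 / I) * ((1 + 0) / (1 - 0)) = -I := by simp
  rw [e] at this
  exact this

lemma h_odd (r : ℝ) (m : ℤ) : ff (pt r 0 (-m)) = - ff (pt r 0 m) := by
  rw [← ff_neg]; congr 1; unfold pt; push_cast; ring

lemma h_bound_s6 {r : ℝ} (hr : 0 < r) (m : ℤ) :
    ‖ff (pt r 0 m)‖ ≤ 2 / (1 - Real.exp (-(2 * r))) := by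
  by_cases hm : m = 0
  · subst hm
    have : pt r 0 0 = 0 := by simp [pt]
    rw [this, ff_zero, norm_zero]
    have : Real.exp (-(2 * r)) < 1 := by rw [Real.exp_lt_one_iff]; linarith
    have : 0 < 1 - Real.exp (-(2 * r)) := by linarith
    positivity
  · refine (bounds (by positivity) ?_).1
    rw [pt_im]
    have : (1:ℝ) ≤ |(m:ℝ)| := by exact_mod_cast Int.one_le_abs hm
    rw [zero_im, zero_add, abs_mul, abs_mul, abs_of_pos hr, abs_two]
    nlinarith

lemma summ {r : ℝ} (hr : 0 < r) (j : ℕ) :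
    Summable (fun k : ℤ => |(k:ℝ)| ^ j * Real.exp (-r * |(k:ℝ)|)) := by
  have := Real.summable_pow_mul_exp_neg_nat_mul j hr
  refine Summable.of_nat_of_neg ?_ ?_ <;> simpa using this

lemma tail {r : ℝ} (hr : 0 < r) (M : ℝ) : ∀ᶠ k : ℤ in cofinite, M ≤ |(k:ℝ)| * r := by
  rw [eventually_cofinite]
  refine (Set.finite_Icc (-⌈M / r⌉) ⌈M / r⌉).subset ?_
  intro k hk
  simp only [Set.mem_ofPred_eq, not_le] at hk
  rw [← lt_div_iff₀ hr] at hk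
  have := hk.trans_le (Int.le_ceil (M / r))
  have h2 : |k| < ⌈M / r⌉ := by exact_mod_cast this
  rw [abs_lt] at h2
  exact ⟨h2.1.le, h2.2.le⟩

lemma im_low {r s M : ℝ} (hr : 0 < r) (hs : r / 2 ≤ s) {w : ℂ} (hw : |w.im| ≤ M) (k : ℤ) :
    |(k:ℝ)| * r - M ≤ |(pt s w k).im| := by
  rw [pt_im]
  have h1 : |2 * (k:ℝ) * s| = 2 * |(k:ℝ)| * s := by
    rw [abs_mul, abs_mul, abs_two, abs_of_pos (by linarith : 0 < s)]
  have h2 := abs_sub_abs_le_abs_sub (2 * (k:ℝ) * s) (- w.im)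
  rw [abs_neg, h1, sub_neg_eq_add, add_comm (2 * (k:ℝ) * s)] at h2
  have := abs_nonneg (k:ℝ)
  nlinarith

lemma loc {r : ℝ} (hr : 0 < r) {z : ℂ} (hz : ∀ k, exp (I * pt r z k) ≠ 1) :
    ∃ ε > 0, ε ≤ r / 2 ∧ ε ≤ 1 ∧ ∀ (s : ℝ) (w : ℂ), dist s r < ε → dist w z < ε →
      (∀ k, exp (I * pt s w k) ≠ 1) ∧ r / 2 ≤ s ∧ |w.im| ≤ |z.im| + 1 := by
  have ht := tail hr (|z.im| + 1 + 1)
  rw [eventually_cofinite] at ht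
  have h1 := (eventually_all_finite ht (l := 𝓝 (r, z))
    (p := fun k p => exp (I * pt p.1 p.2 k) ≠ 1)).2 (by
      intro k _
      have : Continuous fun p : ℝ × ℂ => exp (I * pt p.1 p.2 k) := by
        unfold pt; fun_prop
      exact this.continuousAt.eventually_ne (hz k))
  rw [Metric.eventually_nhds_iff] at h1
  obtain ⟨ε, hε, H⟩ := h1
  refine ⟨min ε (min (r / 2) 1), by positivity, by simp, by simp, ?_⟩
  intro s w hs hw
  simp only [lt_min_iff] at hs hw
  have hs2 : r / 2 ≤ s := by
    have := hs.2.1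
    rw [Real.dist_eq, abs_lt] at this; linarith
  have hw2 : |w.im| ≤ |z.im| + 1 := by
    have := hw.2.2
    rw [Complex.dist_eq] at this
    have h3 := Complex.abs_im_le_norm (w - z)
    rw [sub_im] at h3
    have := abs_sub_abs_le_abs_sub w.im z.im
    linarith
  refine ⟨fun k => ?_, hs2, hw2⟩
  by_cases hk : |z.im| + 1 + 1 ≤ |(k:ℝ)| * r
  · apply exp_ne_one_of_im
    have := im_low hr hs2 hw2 k
    intro h0
    rw [h0, abs_zero] at this
    linarith
  · exact @H (s, w) (by rw [Prod.dist_eq]; exact max_lt hs.1 hw.1) k hk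

lemma tail_bound {r : ℝ} (hr : 0 < r) (M : ℝ) : ∃ C > 0, ∀ᶠ k : ℤ in cofinite,
    ∀ (s : ℝ) (w : ℂ), r / 2 ≤ s → |w.im| ≤ M →
      ‖ff (pt s w k)‖ ≤ C ∧ ‖fd (pt s w k)‖ ≤ C * Real.exp (-r * |(k:ℝ)|) := by
  have hD : 0 < 1 - Real.exp (-1) := by
    have : Real.exp (-1) < 1 := by rw [Real.exp_lt_one_iff]; linarith
    linarith
  refine ⟨max (2 / (1 - Real.exp (-1))) (2 / (1 - Real.exp (-1)) ^ 2 * Real.exp M),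
    by positivity, ?_⟩
  filter_upwards [tail hr (M + 1)] with k hk s w hs hw
  have h1 := im_low hr hs hw k
  obtain ⟨b1, b2⟩ := bounds one_pos (w := pt s w k) (by linarith)
  refine ⟨b1.trans (le_max_left _ _), b2.trans ?_⟩
  have : Real.exp (-|(pt s w k).im|) ≤ Real.exp M * Real.exp (-r * |(k:ℝ)|) := by
    rw [← Real.exp_add]
    apply Real.exp_le_exp.2; linarith
  calc _ ≤ 2 / (1 - Real.exp (-1)) ^ 2 * (Real.exp M * Real.exp (-r * |(k:ℝ)|)) := by gcongr
    _ = (2 / (1 - Real.exp (-1)) ^ 2 * Real.exp M) * Real.exp (-r * |(k:ℝ)|) := by ring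
    _ ≤ _ := by gcongr; exact le_max_right _ _

lemma unif {β : Type*} (F : ℤ → β → ℂ) (s : Set β) (u : ℤ → ℝ) (hu : Summable u)
    (hF : ∀ᶠ k in cofinite, ∀ x ∈ s, ‖F k x‖ ≤ u k) :
    TendstoUniformlyOn (fun (N : ℕ) x => ∑ k ∈ Finset.Icc (-(N:ℤ)) N, F k x)
      (fun x => ∑' k, F k x) atTop s := fun v hv =>
  (Finset.tendsto_Icc_neg (R := ℤ)).eventually
    (tendstoUniformlyOn_tsum_of_cofinite_eventually hu hF v hv)

/-- For every `r > 0`, the identity `∂_r S̃_r − S̃_r·S̃_r′ − S̃_r″ ≡ 0` holds on the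
domain of analyticity (off the poles), where primes denote derivatives in `z`. -/
theorem stmt6 (T : ℝ → ℂ → ℂ)
    (hT : ∀ r : ℝ, 0 < r → ∀ z : ℂ, z ∉ tildePoles r →
      Tendsto (fun N => annulusSumTilde r z N) atTop (𝓝 (T r z))) :
    ∀ r : ℝ, 0 < r → ∀ z : ℂ, z ∉ tildePoles r →
      deriv (fun s : ℝ => T s z) r - T r z * deriv (T r) z - deriv (deriv (T r)) z = 0 := by
  intro r hr z hz
  rw [mem_poles_s6] at hz
  obtain ⟨ε, hε, hε1, hε2, H⟩ := loc hr hz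
  obtain ⟨C, hC, hb⟩ := tail_bound hr (|z.im| + 1)
  have hrr : dist r r < ε := by simpa using hε
  have hzz : dist z z < ε := by simpa using hε
  have u0 : Summable (fun k : ℤ => C * Real.exp (-r * |(k:ℝ)|)) := by
    simpa using (summ hr 0).mul_left C
  -- first derivative in z
  have U1 := unif (fun k w => fd (pt r w k)) (Metric.ball z ε) _ u0 (by
    filter_upwards [hb] with k hk w hw
    exact (hk r w (by linarith) (H r w hrr hw).2.2).2)
  have U2 := unif (fun k w => -(ff (pt r w k) * fd (pt r w k))) (Metric.ball z ε) _
    (u0.mul_left C) (by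
    filter_upwards [hb] with k hk w hw
    obtain ⟨b1, b2⟩ := hk r w (by linarith) (H r w hrr hw).2.2
    rw [norm_neg, norm_mul]
    gcongr)
  have u1 : Summable (fun k : ℤ => 2 * |(k:ℝ)| * (C * Real.exp (-r * |(k:ℝ)|))) := by
    refine ((summ hr 1).mul_left (2 * C)).congr fun k => ?_
    ring
  have nk : ∀ k : ℤ, ‖2 * (k:ℂ) * I‖ = 2 * |(k:ℝ)| := by intro k; simp
  have U3 := unif (fun k (s : ℝ) => 2 * (k:ℂ) * I * fd (pt s z k)) (Metric.ball r ε) _ u1 (by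
    filter_upwards [hb] with k hk s hs
    obtain ⟨b1, b2⟩ := hk s z (H s z hs hzz).2.1 (by linarith)
    rw [norm_mul, nk]
    gcongr)
  have hpt : ∀ w k, HasDerivAt (fun w => pt r w k) 1 w := by
    intro w k
    exact (hasDerivAt_id w).add_const _
  have D1 : ∀ w ∈ Metric.ball z ε, HasDerivAt (T r) (∑' k, fd (pt r w k)) w := by
    intro w hw
    refine hasDerivAt_of_tendstoUniformlyOn (f := fun N w => annulusSumTilde r w N)
      Metric.isOpen_ball U1 ?_ ?_ hw
    · refine Eventually.of_forall fun N x hx => ?_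
      simp only [sum_eq]
      refine HasDerivAt.fun_sum fun k _ => ?_
      exact (HasDerivAt.comp x (hasDerivAt_ff ((H r x hrr hx).1 k)) (hpt x k)).congr_deriv (mul_one _)
    · intro x hx
      exact hT r hr x ((mem_poles_s6 r x).2 (H r x hrr hx).1)
  have D2 : HasDerivAt (fun w => ∑' k, fd (pt r w k))
      (∑' k, -(ff (pt r z k) * fd (pt r z k))) z := by
    refine hasDerivAt_of_tendstoUniformlyOn Metric.isOpen_ball U2 ?_
      (fun x hx => U1.tendsto_at hx) (Metric.mem_ball_self hε)
    refine Eventually.of_forall fun N x hx => ?_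
    refine HasDerivAt.fun_sum fun k _ => ?_
    exact (HasDerivAt.comp x (hasDerivAt_fd ((H r x hrr hx).1 k)) (hpt x k)).congr_deriv (mul_one _)
  have D3 : HasDerivAt (fun s => T s z) (∑' k : ℤ, 2 * (k:ℂ) * I * fd (pt r z k)) r := by
    refine hasDerivAt_of_tendstoUniformlyOn (f := fun N s => annulusSumTilde s z N)
      Metric.isOpen_ball U3 ?_ ?_ (Metric.mem_ball_self hε)
    · refine Eventually.of_forall fun N x hx => ?_
      simp only [sum_eq]
      refine HasDerivAt.fun_sum fun k _ => ?_
      have hp : HasDerivAt (fun s : ℝ => pt s z k) (2 * (k:ℂ) * I) x := by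
        have := (((hasDerivAt_id x).ofReal_comp.const_mul (2 * (k:ℂ))).mul_const I).const_add z
        simpa [pt] using this
      have := HasDerivAt.comp x (hasDerivAt_ff ((H x z hx hzz).1 k)) hp
      exact this.congr_deriv (mul_comm _ _)
    · intro x hx
      obtain ⟨a, b, c⟩ := H x z hx hzz
      exact hT x (by linarith) z ((mem_poles_s6 x z).2 a)
  have E2 : deriv (deriv (T r)) z = ∑' k, -(ff (pt r z k) * fd (pt r z k)) := by
    rw [← D2.deriv]
    apply Filter.EventuallyEq.deriv_eq
    filter_upwards [Metric.ball_mem_nhds z hε] with w hw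
    exact (D1 w hw).deriv
  have hzb := Metric.mem_ball_self (x := z) hε
  rw [E2, (D1 z hzb).deriv, D3.deriv]
  -- limits
  have L0 := hT r hr z ((mem_poles_s6 r z).2 hz)
  simp only [sum_eq] at L0
  have L := (L0.mul (U1.tendsto_at hzb)).add (U2.tendsto_at hzb)
  have key : ∀ N : ℕ, _ = _ := fun N =>
    finite_identity (Finset.Icc (-(N:ℤ)) N) (fun k => ff (pt r z k)) (fun k => fd (pt r z k))
      (fun m => ff (pt r 0 m)) (h_odd r) (by
        intro j k hjk
        have e : pt r 0 (j - k) = pt r z j - pt r z k := by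
          unfold pt; push_cast; ring
        have hne : exp (I * pt r 0 (j - k)) ≠ 1 := by
          apply exp_ne_one_of_im
          rw [pt_im]
          have : ((j - k : ℤ) : ℝ) ≠ 0 := by exact_mod_cast sub_ne_zero.2 hjk
          simp only [zero_im, zero_add]
          positivity
        rw [e] at hne ⊢
        exact addition (hz j) (hz k) hne)
  simp only [key] at L
  set B := 2 / (1 - Real.exp (-(2 * r))) with hB
  have hB0 : 0 ≤ B := (norm_nonneg _).trans (h_bound_s6 hr 0)
  have sfd : Summable (fun k : ℤ => ‖fd (pt r z k)‖ * (2 * B * |(k:ℝ)|)) := by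
    refine Summable.of_norm_bounded_eventually (g := fun k : ℤ =>
      B * (2 * |(k:ℝ)| * (C * Real.exp (-r * |(k:ℝ)|)))) (u1.mul_left B) ?_
    filter_upwards [hb] with k hk
    obtain ⟨b1, b2⟩ := hk r z (by linarith) (by linarith)
    rw [Real.norm_of_nonneg (by positivity)]
    calc _ ≤ (C * Real.exp (-r * |(k:ℝ)|)) * (2 * B * |(k:ℝ)|) := by gcongr
      _ = _ := by ring
  have R := tendsto_tsum_of_dominated_convergence (𝓕 := atTop)
    (f := fun (N : ℕ) (k : ℤ) => if k ∈ Finset.Icc (-(N:ℤ)) N then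
      fd (pt r z k) * ∑ j ∈ Finset.Icc (-(N:ℤ)) N, ff (pt r 0 (j - k)) else 0)
    (g := fun k : ℤ => fd (pt r z k) * (2 * k * I)) sfd (by
      intro k
      have := (A_lim _ (h_odd r) (h_lim hr) k).const_mul (fd (pt r z k))
      refine this.congr' ?_
      filter_upwards [eventually_ge_atTop k.natAbs] with N hN
      rw [if_pos]
      rw [Finset.mem_Icc]; omega) (by
      refine Eventually.of_forall fun N k => ?_
      split_ifs
      · rw [norm_mul]
        gcongr
        exact A_bound _ _ (h_bound_s6 hr) (h_odd r) N k
      · rw [norm_zero]; positivity)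
  have R' : Tendsto (fun N : ℕ => ∑ k ∈ Finset.Icc (-(N:ℤ)) N, fd (pt r z k) *
      ∑ j ∈ Finset.Icc (-(N:ℤ)) N, ff (pt r 0 (j - k))) atTop
      (𝓝 (∑' k : ℤ, fd (pt r z k) * (2 * k * I))) := by
    refine R.congr fun N => ?_
    rw [tsum_eq_sum (s := Finset.Icc (-(N:ℤ)) N)]
    · exact Finset.sum_congr rfl fun k hk => if_pos hk
    · intro k hk; exact if_neg hk
  have fin := tendsto_nhds_unique L R'
  simp only [mul_comm (fd _) (2 * _ * I)] at fin
  rw [← fin]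
  ring
end

section
/- For every r > 0, S̃_r(z) = 2ζ(z) − (2/π)ζ(π)z, where ζ is the Weierstrass zeta function with basic periods (2π, 2ri). -/
open Complex Filter Topology

/-- The Weierstrass zeta function associated with the lattice generated by `ω₁, ω₂`:
`ζ(z) = 1/z + Σ_{ω ∈ Λ \ {0}} (1/(z−ω) + 1/ω + z/ω²)`. -/
noncomputable def weierstrassZeta (ω₁ ω₂ z : ℂ) : ℂ :=
  1 / z + ∑' p : {q : ℤ × ℤ // q ≠ 0},
    (1 / (z - ((p.1.1 : ℂ) * ω₁ + (p.1.2 : ℂ) * ω₂)) +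
      1 / ((p.1.1 : ℂ) * ω₁ + (p.1.2 : ℂ) * ω₂) +
      z / ((p.1.1 : ℂ) * ω₁ + (p.1.2 : ℂ) * ω₂) ^ 2)

noncomputable def lw (r : ℝ) (n m : ℤ) : ℂ :=
  (n : ℂ) * (2 * (Real.pi : ℂ)) + (m : ℂ) * (2 * (r : ℂ) * Complex.I)

noncomputable def zt (r : ℝ) (z : ℂ) (n m : ℤ) : ℂ :=
  1 / (z - lw r n m) + 1 / lw r n m + z / lw r n m ^ 2

lemma lw_re (r : ℝ) (n m : ℤ) : (lw r n m).re = n * (2 * Real.pi) := by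
  simp [lw]

lemma lw_im (r : ℝ) (n m : ℤ) : (lw r n m).im = m * (2 * r) := by
  simp [lw]

lemma lw_norm_ge (r : ℝ) (hr : 0 < r) : ∃ c : ℝ, 0 < c ∧ ∀ q : ℤ × ℤ, c * ‖q‖ ≤ ‖lw r q.1 q.2‖ := by
  refine ⟨min (2 * Real.pi) (2 * r), lt_min (by positivity) (by positivity), fun q => ?_⟩
  rw [Prod.norm_def]
  have h1 := Complex.abs_re_le_norm (lw r q.1 q.2)
  have h2 := Complex.abs_im_le_norm (lw r q.1 q.2)
  rw [lw_re, abs_mul, abs_of_pos (by positivity : 0 < 2 * Real.pi)] at h1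
  rw [lw_im, abs_mul, abs_of_pos (by positivity : 0 < 2 * r)] at h2
  rcases max_choice ‖q.1‖ ‖q.2‖ with h | h <;> rw [h, Int.norm_eq_abs]
  · refine le_trans ?_ h1
    rw [mul_comm]
    exact mul_le_mul_of_nonneg_left (min_le_left _ _) (abs_nonneg _)
  · refine le_trans ?_ h2
    rw [mul_comm]
    exact mul_le_mul_of_nonneg_left (min_le_right _ _) (abs_nonneg _)

lemma sum3 : Summable fun q : ℤ × ℤ => ‖q‖ ^ (-3 : ℝ) := by
  have h := EisensteinSeries.summable_one_div_norm_rpow (k := 3) (by norm_num)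
  rw [← (finTwoArrowEquiv _).symm.summable_iff] at h
  refine h.congr fun q => ?_
  simp only [Function.comp_apply, finTwoArrowEquiv_symm_apply]
  congr 1
  rw [EisensteinSeries.norm_eq_max_natAbs, Prod.norm_def, Int.norm_eq_abs, Int.norm_eq_abs]
  simp

lemma zt_summable (r : ℝ) (hr : 0 < r) (z : ℂ) :
    Summable fun q : ℤ × ℤ => zt r z q.1 q.2 := by
  obtain ⟨c, hc, hq⟩ := lw_norm_ge r hr
  refine summable_of_isBigO sum3 (Asymptotics.IsBigO.of_bound (2 * ‖z‖ ^ 2 / c ^ 3) ?_)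
  have ht : Tendsto (fun q : ℤ × ℤ => ‖q‖) cofinite atTop := by
    rw [← cocompact_eq_cofinite]
    exact tendsto_norm_cocompact_atTop
  filter_upwards [ht.eventually_ge_atTop (2 * ‖z‖ / c), ht.eventually_gt_atTop 0] with q h1 h2
  have h3 := hq q
  rw [div_le_iff₀ hc] at h1
  unfold zt
  set w := lw r q.1 q.2
  have hw : 0 < ‖w‖ := lt_of_lt_of_le (by positivity) h3
  have hw0 : w ≠ 0 := norm_pos_iff.1 hw
  have h4 : ‖w‖ / 2 ≤ ‖z - w‖ := by
    have := norm_sub_norm_le w z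
    rw [norm_sub_rev] at this
    linarith
  have hzw : z - w ≠ 0 := norm_pos_iff.1 (by linarith)
  have e : 1 / (z - w) + 1 / w + z / w ^ 2 = z ^ 2 / (w ^ 2 * (z - w)) := by
    field_simp
    ring
  rw [e, norm_div, norm_mul, norm_pow, norm_pow, Real.norm_of_nonneg (by positivity),
    Real.rpow_neg (norm_nonneg _)]
  rw [show (3 : ℝ) = ((3 : ℕ) : ℝ) by norm_num, Real.rpow_natCast]
  calc ‖z‖ ^ 2 / (‖w‖ ^ 2 * ‖z - w‖) ≤ ‖z‖ ^ 2 / ((c * ‖q‖) ^ 2 * ((c * ‖q‖) / 2)) := by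
        gcongr
        linarith
    _ = _ := by field_simp

lemma zeta_eq (r : ℝ) (hr : 0 < r) (z : ℂ) :
    weierstrassZeta (2 * (Real.pi : ℂ)) (2 * (r : ℂ) * Complex.I) z
      = ∑' q : ℤ × ℤ, zt r z q.1 q.2 := by
  have h := (zt_summable r hr z).tsum_eq_add_tsum_ite (0 : ℤ × ℤ)
  have h2 := tsum_subtype {q : ℤ × ℤ | q ≠ 0} (fun q => zt r z q.1 q.2)
  rw [h, weierstrassZeta]
  congr 1
  · simp [zt, lw]
  · refine Eq.trans h2 (tsum_congr fun q => ?_)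
    by_cases hq : q = 0 <;> simp [hq]

lemma sum_Icc_neg (f : ℤ → ℂ) (N : ℕ) :
    ∑ k ∈ Finset.Icc (-(N : ℤ)) N, f (-k) = ∑ k ∈ Finset.Icc (-(N : ℤ)) N, f k := by
  refine Finset.sum_nbij' (fun k => -k) (fun k => -k) ?_ ?_ ?_ ?_ ?_ <;> simp <;> grind

lemma sum_Icc_odd (f : ℤ → ℂ) (hf : ∀ k, f (-k) = - f k) (N : ℕ) :
    ∑ k ∈ Finset.Icc (-(N : ℤ)) N, f k = 0 := by
  have h := sum_Icc_neg f N
  simp only [hf, Finset.sum_neg_distrib] at h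
  exact self_eq_neg.1 h.symm

lemma sum_Icc_succ (f : ℤ → ℂ) (N : ℕ) :
    ∑ k ∈ Finset.Icc (-(N : ℤ)) N, f k
      = f 0 + ∑ j ∈ Finset.range N, (f (j + 1) + f (-(j + 1))) := by
  induction N with
  | zero => simp
  | succ N ih =>
    rw [Finset.sum_range_succ, ← add_assoc, ← ih]
    have : Finset.Icc (-((N + 1 : ℕ) : ℤ)) ((N + 1 : ℕ) : ℤ)
        = insert (-((N : ℤ) + 1)) (insert ((N : ℤ) + 1) (Finset.Icc (-(N : ℤ)) N)) := by
      ext x; simp; omega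
    rw [this, Finset.sum_insert (by simp; omega), Finset.sum_insert (by simp)]
    ring

lemma cot_tendsto (u : ℂ) (hu : ∀ n : ℤ, u ≠ n * (2 * (Real.pi : ℂ))) :
    Tendsto (fun N : ℕ => ∑ n ∈ Finset.Icc (-(N : ℤ)) N, 1 / (u - n * (2 * (Real.pi : ℂ))))
      atTop (𝓝 (Complex.cot (u / 2) / 2)) := by
  have hp : (Real.pi : ℂ) ≠ 0 := by exact_mod_cast Real.pi_ne_zero
  have hx : u / (2 * Real.pi) ∈ Complex.integerComplement := by
    rintro ⟨n, hn⟩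
    apply hu n
    rw [hn]; field_simp
  have h := ((tendsto_logDeriv_euler_cot_sub hx).const_add (1 / (u / (2 * Real.pi)))).const_mul
    (1 / (2 * (Real.pi : ℂ)))
  have e : 1 / (2 * (Real.pi : ℂ)) * (1 / (u / (2 * Real.pi)) +
      (Real.pi * Complex.cot (Real.pi * (u / (2 * Real.pi))) - 1 / (u / (2 * Real.pi))))
      = Complex.cot (u / 2) / 2 := by
    rw [show (Real.pi : ℂ) * (u / (2 * Real.pi)) = u / 2 by field_simp]
    rw [add_sub_cancel]
    field_simp
  rw [e] at h
  refine h.congr fun N => ?_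
  rw [sum_Icc_succ, mul_add, Finset.mul_sum]
  have key : ∀ t : ℂ, 1 / (2 * (Real.pi : ℂ)) * (1 / (u / (2 * Real.pi) - t))
      = 1 / (u - t * (2 * Real.pi)) := by
    intro t
    rw [one_div_mul_one_div]
    congr 1
    field_simp
  congr 1
  · have := key 0
    simpa using this
  · refine Finset.sum_congr rfl fun j _ => ?_
    have h1 := key (j + 1)
    have h2 := key (-(j + 1))
    rw [cotTerm, mul_add, h1, ← sub_neg_eq_add _ ((j : ℂ) + 1), h2]
    push_cast
    ring

lemma cot_neg' (x : ℂ) : Complex.cot (-x) = - Complex.cot x := by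
  simp [Complex.cot, neg_div, div_neg]

lemma inv_tendsto (r : ℝ) (hr : 0 < r) (m : ℤ) :
    Tendsto (fun N : ℕ => ∑ n ∈ Finset.Icc (-(N : ℤ)) N, 1 / lw r n m)
      atTop (𝓝 (Complex.cot (m * r * Complex.I) / 2)) := by
  by_cases hm : m = 0
  · subst hm
    have : ∀ N : ℕ, ∑ n ∈ Finset.Icc (-(N : ℤ)) N, 1 / lw r n 0 = 0 := by
      intro N
      apply sum_Icc_odd
      intro k
      simp [lw, div_neg]
    simp only [this]
    simp [Complex.cot]
  · have h := cot_tendsto (m * (2 * r * Complex.I)) (by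
      intro n hn
      have := congrArg Complex.im hn
      simp [hm, hr.ne'] at this)
    rw [show (m : ℂ) * (2 * r * Complex.I) / 2 = m * r * Complex.I by ring] at h
    refine h.congr fun N => ?_
    rw [← sum_Icc_neg]
    refine Finset.sum_congr rfl fun n _ => ?_
    rw [lw]; push_cast; ring_nf

lemma row_tendsto (r : ℝ) (z : ℂ) (hz : z ∉ tildePoles r) (m : ℤ) :
    Tendsto (fun N : ℕ => ∑ n ∈ Finset.Icc (-(N : ℤ)) N, 1 / (z - lw r n m))
      atTop (𝓝 (Complex.cot ((z - m * (2 * r * Complex.I)) / 2) / 2)) := by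
  have h := cot_tendsto (z - m * (2 * r * Complex.I)) (by
    intro n hn
    apply hz
    refine ⟨n, m, ?_⟩
    linear_combination hn)
  refine h.congr fun N => ?_
  refine Finset.sum_congr rfl fun n _ => ?_
  rw [lw]; ring_nf

lemma tilde_eq (r : ℝ) (z : ℂ) (N : ℕ) :
    annulusSumTilde r z N
      = ∑ m ∈ Finset.Icc (-(N : ℤ)) N, Complex.cot ((z - m * (2 * r * Complex.I)) / 2) := by
  rw [← sum_Icc_neg, annulusSumTilde, annulusSum, Finset.mul_sum]
  refine Finset.sum_congr rfl fun k _ => ?_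
  rw [Complex.cot_eq_exp_ratio]
  have e : Complex.exp (Complex.I * z) = Complex.exp (2 * k * r) *
      Complex.exp (2 * Complex.I * ((z - ((-k : ℤ) : ℂ) * (2 * r * Complex.I)) / 2)) := by
    rw [← Complex.exp_add]
    congr 1
    push_cast
    linear_combination (-2 * (k : ℂ) * r) * Complex.I_sq
  rw [e]
  generalize Complex.exp (2 * Complex.I * ((z - ((-k : ℤ) : ℂ) * (2 * r * Complex.I)) / 2)) = y
  have h0 := Complex.exp_ne_zero (2 * k * r)
  generalize Complex.exp (2 * k * r) = x at *
  rw [show x + x * y = x * (y + 1) by ring, show x - x * y = x * (1 - y) by ring,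
    mul_div_mul_left _ _ h0, div_mul_div_comm, one_mul]

lemma pi_notMem (r : ℝ) (hr : 0 < r) : (Real.pi : ℂ) ∉ tildePoles r := by
  rintro ⟨k, m, h⟩
  have := congrArg Complex.re h
  simp at this
  have h4 : 2 * k = 1 := by
    have h5 : ((2 * k : ℤ) : ℝ) = ((1 : ℤ) : ℝ) := by
      push_cast
      first | exact this | (trace_state; simpa using this)
    exact Int.cast_injective h5
  omega

lemma cot_pi_odd (x : ℂ) : Complex.cot ((Real.pi + x) / 2) = - Complex.cot ((Real.pi - x) / 2) := by
  rw [show ((Real.pi : ℂ) + x) / 2 = Real.pi - (Real.pi - x) / 2 by ring]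
  simp [Complex.cot, Complex.cos_pi_sub, Complex.sin_pi_sub, neg_div]

/-- For every `r > 0`, `S̃_r(z) = 2ζ(z) − (2/π)ζ(π)z`, where `ζ` is the Weierstrass zeta
function with basic periods `(2π, 2ri)`. -/
theorem stmt7 (r : ℝ) (hr : 0 < r) (T : ℂ → ℂ)
    (hT : ∀ z : ℂ, z ∉ tildePoles r →
      Tendsto (fun N => annulusSumTilde r z N) atTop (𝓝 (T z))) :
    ∀ z : ℂ, z ∉ tildePoles r →
      T z = 2 * weierstrassZeta (2 * (Real.pi : ℂ)) (2 * (r : ℂ) * Complex.I) z -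
        (2 / (Real.pi : ℂ)) *
          weierstrassZeta (2 * (Real.pi : ℂ)) (2 * (r : ℂ) * Complex.I) (Real.pi : ℂ) * z := by
  intro z hz
  have hp : (Real.pi : ℂ) ≠ 0 := by exact_mod_cast Real.pi_ne_zero
  have hpi := pi_notMem r hr
  rw [zeta_eq r hr, zeta_eq r hr]
  set a : ℂ := z / Real.pi with ha
  have hsz := zt_summable r hr z
  have hsp := zt_summable r hr (Real.pi : ℂ)
  have hs := hsz.sub (hsp.mul_left a)
  have hsum := hsz.hasSum.sub (hsp.hasSum.mul_left a)
  have hsum' := (Equiv.prodComm ℤ ℤ).hasSum_iff.2 hsum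
  have hrow : ∀ m : ℤ, HasSum (fun n : ℤ => zt r z n m - a * zt r Real.pi n m)
      (Complex.cot ((z - m * (2 * r * Complex.I)) / 2) / 2
        - a * (Complex.cot ((Real.pi - m * (2 * r * Complex.I)) / 2) / 2)
        + (1 - a) * (Complex.cot (m * r * Complex.I) / 2)) := by
    intro m
    have h1 : Summable (fun n : ℤ => zt r z n m - a * zt r Real.pi n m) :=
      hsum'.summable.prod_factor m
    have h2 := h1.hasSum.comp Finset.tendsto_Icc_neg
    have h3 := ((row_tendsto r z hz m).sub ((row_tendsto r _ hpi m).const_mul a)).add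
      ((inv_tendsto r hr m).const_mul (1 - a))
    have h4 := h3.congr' (f₂ := fun N : ℕ => ∑ n ∈ Finset.Icc (-(N : ℤ)) N,
        (zt r z n m - a * zt r Real.pi n m)) (Eventually.of_forall fun N => by
      simp only [Finset.mul_sum]
      rw [← Finset.sum_sub_distrib, ← Finset.sum_add_distrib]
      refine Finset.sum_congr rfl fun n _ => ?_
      have : z = a * Real.pi := by rw [ha]; field_simp
      unfold zt
      generalize lw r n m = w
      have : z / w ^ 2 = a * (Real.pi / w ^ 2) := by rw [← mul_div_assoc, ← this]
      rw [this]
      ring)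
    rw [← tendsto_nhds_unique h2 h4]
    exact h1.hasSum
  have hfin := (hsum'.prod_fiberwise hrow).comp Finset.tendsto_Icc_neg
  have hT' := (hT z hz).div_const 2
  have key : ∀ N : ℕ, annulusSumTilde r z N / 2 = ∑ m ∈ Finset.Icc (-(N : ℤ)) N,
      (Complex.cot ((z - m * (2 * r * Complex.I)) / 2) / 2
        - a * (Complex.cot ((Real.pi - m * (2 * r * Complex.I)) / 2) / 2)
        + (1 - a) * (Complex.cot (m * r * Complex.I) / 2)) := by
    intro N
    rw [tilde_eq, Finset.sum_add_distrib, Finset.sum_sub_distrib, ← Finset.mul_sum,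
      ← Finset.mul_sum, ← Finset.sum_div]
    rw [sum_Icc_odd (fun m => Complex.cot ((Real.pi - m * (2 * r * Complex.I)) / 2) / 2),
      sum_Icc_odd (fun m => Complex.cot (m * r * Complex.I) / 2)]
    · ring
    · intro k
      rw [← neg_div, ← cot_neg']
      push_cast
      ring_nf
    · intro k
      rw [← neg_div, ← cot_pi_odd]
      push_cast
      ring_nf
  have h5 := tendsto_nhds_unique (hT'.congr key) hfin
  have h6 : T z = 2 * (T z / 2) := by ring
  rw [h6, h5, ha]
  ring
end

section
/- Let G, A, B be as above, C = V \ (A∪B), and fix x ∈ C. Let h(v) be the probability that a simple random walk from v hits x before A ∪ B, and f(v) the probability it hits A before B. Then Σ_{v∈A} Δ_G h(v) = f(x) · (−Δ_G h(x)). -/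
open Filter

/-- The weight `P₀(γ) = 1/∏_{j=0}^{n-1} deg(γⱼ)` of a walk `γ = (γ₀,…,γₙ)`
(product of reciprocal degrees over all vertices except the last). -/
noncomputable def walkWeight {V : Type*} (G : SimpleGraph V) [G.LocallyFinite]
    {v w : V} (γ : G.Walk v w) : ℝ :=
  (γ.support.dropLast.map fun u => ((G.degree u : ℝ))⁻¹).prod

/-- The probability that the simple random walk on `G` started at `v` hits `A`
before `B`: the sum of the weights of all walk trajectories from `v` ending at a
vertex of `A`, all of whose other vertices avoid `A ∪ B`. -/
noncomputable def hitBefore {V : Type*} (G : SimpleGraph V) [G.LocallyFinite]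
    (A B : Set V) (v : V) : ℝ :=
  ∑' γ : (Σ a : A, {w : G.Walk v (a : V) // ∀ u ∈ w.support.dropLast, u ∉ A ∪ B}),
    walkWeight G (γ.2 : G.Walk v (γ.1 : V))

/-- The graph Laplacian `Δ_G f(v) = Σ_{w∼v} (f(w) − f(v))`. -/
noncomputable def graphLap {V : Type*} (G : SimpleGraph V) [G.LocallyFinite]
    (f : V → ℝ) (v : V) : ℝ :=
  ∑ w ∈ G.neighborFinset v, (f w - f v)

open scoped ENNReal Classical in
noncomputable def eW {V : Type*} (G : SimpleGraph V) [G.LocallyFinite] (D : Set V) (v : V) : ℝ≥0∞ :=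
  if v ∈ D then 0 else ENNReal.ofReal ((G.degree v : ℝ)⁻¹)

open scoped ENNReal Classical in
noncomputable def pW {V : Type*} (G : SimpleGraph V) [G.LocallyFinite] (D : Set V) :
    ℕ → V → V → ℝ≥0∞
  | 0, v, w => if v = w then 1 else 0
  | n+1, v, w => eW G D v * ∑ u ∈ G.neighborFinset v, pW G D n u w

open scoped ENNReal in
noncomputable def gW {V : Type*} (G : SimpleGraph V) [G.LocallyFinite] (D : Set V) (v w : V) : ℝ≥0∞ :=
  ∑' n, pW G D n v w

open scoped ENNReal Classical in
noncomputable def wtW {V : Type*} (G : SimpleGraph V) [G.LocallyFinite] (D : Set V) {v w : V}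
    (γ : G.Walk v w) : ℝ≥0∞ :=
  if (∀ u ∈ γ.support.dropLast, u ∉ D) then ENNReal.ofReal (walkWeight G γ) else 0

section
open scoped ENNReal Classical
variable {V : Type*} (G : SimpleGraph V) [G.LocallyFinite] (D : Set V)

def walkEquiv (v w : V) :
    G.Walk v w ≃ (PLift (v = w)) ⊕ (Σ u : {u // G.Adj v u}, G.Walk (u : V) w) where
  toFun
    | .nil => .inl ⟨rfl⟩
    | .cons h p => .inr ⟨⟨_, h⟩, p⟩
  invFun
    | .inl ⟨h⟩ => h ▸ .nil
    | .inr ⟨u, p⟩ => .cons u.2 p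
  left_inv γ := by cases γ <;> rfl
  right_inv s := by
    rcases s with ⟨⟨h⟩⟩ | ⟨u, p⟩
    · subst h; rfl
    · rfl

theorem tsum_walk (v w : V) (F : G.Walk v w → ℝ≥0∞) :
    ∑' γ, F γ = (if h : v = w then F (h ▸ .nil) else 0)
      + ∑' u : {u // G.Adj v u}, ∑' γ : G.Walk (u : V) w, F (.cons u.2 γ) := by
  rw [← (walkEquiv G v w).symm.tsum_eq F, Summable.tsum_sum ENNReal.summable ENNReal.summable, ENNReal.tsum_sigma']
  congr 1
  split_ifs with h
  · subst h
    rw [tsum_eq_single ⟨rfl⟩ (by rintro ⟨h⟩ h2; exact absurd rfl h2)]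
    rfl
  · haveI : IsEmpty (PLift (v = w)) := ⟨fun a => h a.down⟩
    simp

theorem wt_nil (v : V) : wtW G D (.nil : G.Walk v v) = 1 := by
  simp [wtW, walkWeight]

theorem wt_cons {v u w : V} (h : G.Adj v u) (γ : G.Walk u w) :
    wtW G D (.cons h γ) = eW G D v * wtW G D γ := by
  have h1 : (SimpleGraph.Walk.cons h γ).support.dropLast = v :: γ.support.dropLast := by
    rw [SimpleGraph.Walk.support_cons, List.dropLast_cons_of_ne_nil γ.support_ne_nil]
  unfold wtW eW walkWeight
  rw [h1]
  by_cases hv : v ∈ D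
  · simp [hv]
  · by_cases h2 : ∀ u ∈ γ.support.dropLast, u ∉ D
    · have h3 : ∀ u ∈ v :: γ.support.dropLast, u ∉ D := by
        intro u hu
        rcases List.mem_cons.1 hu with rfl | hu
        · exact hv
        · exact h2 u hu
      rw [if_pos h2, if_pos h3, if_neg hv, List.map_cons, List.prod_cons,
        ENNReal.ofReal_mul (by positivity)]
    · have h3 : ¬ ∀ u ∈ v :: γ.support.dropLast, u ∉ D := fun h => h2 fun u hu =>
        h u (List.mem_cons_of_mem _ hu)
      rw [if_neg h2, if_neg h3, mul_zero]

theorem tsum_nbr (v : V) (F : V → ℝ≥0∞) :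
    ∑' u : {u // G.Adj v u}, F u = ∑ u ∈ G.neighborFinset v, F u := by
  rw [← Finset.tsum_subtype]
  exact (Equiv.subtypeEquivRight (fun u => by simp) : {u // u ∈ G.neighborFinset v} ≃ {u // G.Adj v u}).tsum_eq
    (fun u : {u // G.Adj v u} => F u) |>.symm

theorem tsum_len (n : ℕ) (v w : V) :
    ∑' γ : G.Walk v w, (if γ.length = n then wtW G D γ else 0) = pW G D n v w := by
  induction n generalizing v with
  | zero =>
    rw [tsum_walk]
    simp only [SimpleGraph.Walk.length_cons, Nat.add_eq_zero_iff, one_ne_zero, and_false, if_false, tsum_zero, add_zero, pW]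
    by_cases h : v = w
    · subst h; simp [wt_nil]
    · simp [h]
  | succ n ih =>
    rw [tsum_walk]
    have h0 : (if h : v = w then (if ((h ▸ SimpleGraph.Walk.nil : G.Walk v w)).length = n + 1 then wtW G D ((h ▸ SimpleGraph.Walk.nil : G.Walk v w)) else 0) else 0) = 0 := by
      by_cases h : v = w
      · subst h; simp
      · simp [h]
    rw [h0, zero_add, pW, ← tsum_nbr G v (fun u => pW G D n u w), ← ENNReal.tsum_mul_left]
    refine tsum_congr fun u => ?_
    rw [← ih, ← ENNReal.tsum_mul_left]
    refine tsum_congr fun γ => ?_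
    simp [wt_cons]

theorem tsum_wt (v w : V) : ∑' γ : G.Walk v w, wtW G D γ = gW G D v w := by
  unfold gW
  simp_rw [← tsum_len]
  rw [ENNReal.tsum_comm]
  refine tsum_congr fun γ => ?_
  simp

theorem hit_eq (A B : Set V) (v : V) :
    hitBefore G A B v = (∑' a : A, gW G (A ∪ B) v a).toReal := by
  have h1 : ∀ a : A, gW G (A ∪ B) v a = ∑' γ : {w : G.Walk v (a : V) // ∀ u ∈ w.support.dropLast, u ∉ A ∪ B},
      ENNReal.ofReal (walkWeight G (γ : G.Walk v (a:V))) := by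
    intro a
    rw [← tsum_wt]
    have := tsum_subtype {w : G.Walk v (a : V) | ∀ u ∈ w.support.dropLast, u ∉ A ∪ B} (fun γ => ENNReal.ofReal (walkWeight G γ))
    refine Eq.trans ?_ this.symm
    refine tsum_congr fun γ => ?_
    simp only [wtW, Set.indicator, Set.mem_ofPred_eq]
    congr
  simp_rw [h1]
  rw [← ENNReal.tsum_sigma' (fun γ : (Σ a : A, {w : G.Walk v (a : V) // ∀ u ∈ w.support.dropLast, u ∉ A ∪ B}) => ENNReal.ofReal (walkWeight G (γ.2 : G.Walk v (γ.1 : V)))),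
    ENNReal.tsum_toReal_eq (fun _ => ENNReal.ofReal_ne_top)]
  unfold hitBefore
  refine tsum_congr fun γ => ?_
  rw [ENNReal.toReal_ofReal]
  unfold walkWeight
  apply List.prod_nonneg
  intro a ha
  obtain ⟨u, -, rfl⟩ := List.mem_map.1 ha
  positivity

theorem pW_right (n : ℕ) (v w : V) :
    pW G D (n+1) v w = ∑ u ∈ G.neighborFinset w, pW G D n v u * eW G D u := by
  induction n generalizing v with
  | zero =>
    simp only [pW, ite_mul, one_mul, zero_mul, Finset.sum_ite_eq, Finset.sum_ite_eq', SimpleGraph.mem_neighborFinset, G.adj_comm w v]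
    split_ifs <;> simp
  | succ n ih =>
    rw [pW]
    simp_rw [ih]
    rw [Finset.sum_comm, Finset.mul_sum]
    refine Finset.sum_congr rfl fun t _ => ?_
    rw [pW, ← Finset.sum_mul, mul_assoc]

theorem pW_symm (n : ℕ) (v x : V) :
    ∑ w ∈ G.neighborFinset v, pW G D n w x = ∑ u ∈ G.neighborFinset x, pW G D n u v := by
  induction n generalizing v with
  | zero =>
    simp only [pW, Finset.sum_ite_eq', SimpleGraph.mem_neighborFinset, G.adj_comm]
  | succ n ih =>
    simp_rw [pW_right G D n _ v]
    rw [Finset.sum_comm]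
    refine Finset.sum_congr rfl fun w _ => ?_
    rw [pW, ih, ← Finset.sum_mul, mul_comm]

theorem gW_symm (v x : V) :
    ∑ w ∈ G.neighborFinset v, gW G D w x = ∑ u ∈ G.neighborFinset x, gW G D u v := by
  unfold gW
  rw [← Summable.tsum_finsetSum (fun _ _ => ENNReal.summable), ← Summable.tsum_finsetSum (fun _ _ => ENNReal.summable)]
  exact tsum_congr fun n => pW_symm G D n v x

theorem gW_first (v w : V) :
    gW G D v w = (if v = w then 1 else 0) + eW G D v * ∑ u ∈ G.neighborFinset v, gW G D u w := by
  unfold gW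
  rw [tsum_eq_zero_add' ENNReal.summable, ← Summable.tsum_finsetSum (fun _ _ => ENNReal.summable), ← ENNReal.tsum_mul_left]
  rfl

theorem gW_mem {v : V} (hv : v ∈ D) (w : V) : gW G D v w = if v = w then 1 else 0 := by
  rw [gW_first]; simp [eW, hv]

theorem pW_renew (x a : V) (hxa : x ≠ a) (n : ℕ) (u : V) :
    pW G D n u a = pW G (insert x D) n u a
      + ∑ ij ∈ Finset.HasAntidiagonal.antidiagonal n, pW G (insert x D) ij.1 u x * pW G D ij.2 x a := by
  induction n generalizing u with
  | zero => simp [pW, hxa]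
  | succ n ih =>
    rw [Finset.Nat.sum_antidiagonal_succ]
    by_cases hu : u = x
    · subst hu
      simp [pW, eW]
    · have he : eW G (insert x D) u = eW G D u := by simp [eW, hu]
      simp only [pW, he, hu, if_false, zero_mul, zero_add]
      simp_rw [mul_assoc, ← Finset.mul_sum]
      rw [← mul_add]
      congr 1
      simp_rw [Finset.sum_mul]
      rw [Finset.sum_comm, ← Finset.sum_add_distrib]
      exact Finset.sum_congr rfl fun t _ => ih t

theorem gW_renew (x a : V) (hxa : x ≠ a) (u : V) :
    gW G D u a = gW G (insert x D) u a + gW G (insert x D) u x * gW G D x a := by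
  unfold gW
  rw [tsum_congr fun n => pW_renew G D x a hxa n u]
  rw [ENNReal.tsum_add]
  congr 1
  rw [← ENNReal.tsum_mul_right]
  simp_rw [← ENNReal.tsum_mul_left]
  rw [← ENNReal.tsum_prod (f := fun i j => pW G (insert x D) i u x * pW G D j x a),
    ← Finset.HasAntidiagonal.sigmaAntidiagonalEquivProd.tsum_eq, ENNReal.tsum_sigma']
  refine tsum_congr fun n => ?_
  rw [← Finset.tsum_subtype]
  rfl

end

/-- With `C = V \ (A∪B)` and `x ∈ C`, let `h(v)` be the probability that a simple
random walk from `v` hits `x` before `A ∪ B`, and `f(v)` the probability it hits `A`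
before `B`. Then `Σ_{v∈A} Δ_G h(v) = f(x)·(−Δ_G h(x))`. -/
theorem stmt12 {V : Type*} (G : SimpleGraph V) [G.LocallyFinite]
    (hconn : G.Connected) (A B : Set V) (hAB : Disjoint A B)
    (hreach : ∀ v : V, v ∉ A ∪ B → hitBefore G (A ∪ B) ∅ v = 1)
    (x : V) (hx : x ∉ A ∪ B) :
    (∑' v : A, graphLap G (hitBefore G {x} (A ∪ B)) v) =
      hitBefore G A B x * (-(graphLap G (hitBefore G {x} (A ∪ B)) x)) := by
  classical
  set D := A ∪ B with hD
  have hxa : ∀ a ∈ D, x ≠ a := fun a ha h => hx (h ▸ ha)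
  have hh : ∀ v, hitBefore G {x} D v = (gW G (insert x D) v x).toReal := by
    intro v
    rw [hit_eq, tsum_singleton x (fun a => gW G ({x} ∪ D) v a), Set.singleton_union]
  have hT : ∀ v, v ∉ D → ∑' a : D, gW G D v a = 1 := by
    intro v hv
    have := hreach v hv
    rw [hit_eq, Set.union_empty] at this
    rw [← ENNReal.ofReal_toReal (a := ∑' a : D, gW G D v a), this, ENNReal.ofReal_one]
    intro h
    rw [h] at this
    simp at this
  have hfin : ∀ v, gW G (insert x D) v x ≤ 1 := by
    intro v
    by_cases hv : v ∈ D
    · rw [gW_mem G _ (Set.mem_insert_of_mem _ hv)]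
      split_ifs <;> simp
    · rw [← hT v hv]
      calc gW G (insert x D) v x = gW G (insert x D) v x * ∑' a : D, gW G D x a := by
            rw [hT x hx, mul_one]
        _ = ∑' a : D, gW G (insert x D) v x * gW G D x a := ENNReal.tsum_mul_left.symm
        _ ≤ _ := ENNReal.tsum_le_tsum fun a => by
            rw [gW_renew G D x a (hxa a a.2) v]; exact le_add_self
  have hfin' : ∀ v, gW G (insert x D) v x ≠ ⊤ := fun v => ((hfin v).trans_lt ENNReal.one_lt_top).ne
  have hQ : ∀ v, ∑ w ∈ G.neighborFinset v, gW G (insert x D) w x ≠ ⊤ := fun v =>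
    ENNReal.sum_ne_top.2 fun w _ => hfin' w
  have hlapA : ∀ v : A, graphLap G (hitBefore G {x} D) v =
      (∑ w ∈ G.neighborFinset (v : V), gW G (insert x D) w x).toReal := by
    intro v
    have hvD : (v : V) ∈ D := Or.inl v.2
    have h0 : hitBefore G {x} D v = 0 := by
      rw [hh, gW_mem G _ (Set.mem_insert_of_mem _ hvD), if_neg (hxa v hvD).symm]; rfl
    unfold graphLap
    rw [h0, ENNReal.toReal_sum (fun w _ => hfin' w)]
    simp [hh]
  have hlapx : graphLap G (hitBefore G {x} D) x =
      (∑ w ∈ G.neighborFinset x, gW G (insert x D) w x).toReal - G.degree x := by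
    have h0 : hitBefore G {x} D x = 1 := by
      rw [hh, gW_mem G _ (Set.mem_insert _ _)]; simp
    unfold graphLap
    rw [h0, ENNReal.toReal_sum (fun w _ => hfin' w), Finset.sum_sub_distrib]
    simp [hh]
  have hf : ∑' a : A, gW G D x a ≠ ⊤ := by
    have : ∑' a : A, gW G D x a ≤ ∑' a : D, gW G D x a :=
      ENNReal.tsum_mono_subtype (fun a => gW G D x a) (Set.subset_union_left)
    rw [hT x hx] at this
    exact (this.trans_lt ENNReal.one_lt_top).ne
  have hdeg : ∀ a ∈ D, (G.degree x : ENNReal) * gW G D x a = ∑ u ∈ G.neighborFinset x, gW G D u a := by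
    intro a ha
    rw [gW_first, if_neg (hxa a ha), zero_add, ← mul_assoc]
    by_cases h0 : G.degree x = 0
    · have : G.neighborFinset x = ∅ := by
        rw [← Finset.card_eq_zero]; simpa using h0
      simp [this]
    · have : (G.degree x : ENNReal) * eW G D x = 1 := by
        have hpos : (0:ℝ) < G.degree x := by exact_mod_cast Nat.pos_of_ne_zero h0
        rw [eW, if_neg hx, ENNReal.ofReal_inv_of_pos hpos, ENNReal.ofReal_natCast]
        exact ENNReal.mul_inv_cancel (by exact_mod_cast h0) (ENNReal.natCast_ne_top _)
      rw [this, one_mul]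
  have key : (G.degree x : ENNReal) * ∑' a : A, gW G D x a =
      (∑' a : A, ∑ w ∈ G.neighborFinset (a : V), gW G (insert x D) w x) +
      (∑ w ∈ G.neighborFinset x, gW G (insert x D) w x) * ∑' a : A, gW G D x a := by
    rw [← ENNReal.tsum_mul_left, ← ENNReal.tsum_mul_left, ← ENNReal.tsum_add]
    refine tsum_congr fun a => ?_
    have ha : (a : V) ∈ D := Or.inl a.2
    rw [hdeg a ha, gW_symm G (insert x D) a x, Finset.sum_mul, ← Finset.sum_add_distrib]
    exact Finset.sum_congr rfl fun u _ => gW_renew G D x a (hxa a ha) u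
  have hL : (∑' a : A, ∑ w ∈ G.neighborFinset (a : V), gW G (insert x D) w x) ≠ ⊤ := by
    have h1 : (G.degree x : ENNReal) * ∑' a : A, gW G D x a ≠ ⊤ :=
      ENNReal.mul_ne_top (ENNReal.natCast_ne_top _) hf
    rw [key] at h1
    exact (ENNReal.add_ne_top.1 h1).1
  have key2 := congrArg ENNReal.toReal key
  rw [ENNReal.toReal_add hL (ENNReal.mul_ne_top (hQ x) hf), ENNReal.toReal_mul,
    ENNReal.toReal_mul, ENNReal.toReal_natCast, ENNReal.tsum_toReal_eq (fun a : A => hQ a)] at key2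
  rw [tsum_congr hlapA, hlapx, hit_eq]
  linarith
end

section
/- Let Ω₁ ⊂ Ω₂ ⊂ ... be domains converging to a domain Ω (every compact subset of Ω is eventually contained in Ω_n, and every boundary point of Ω is a limit of boundary points of Ω_n). Suppose f_n : Ω_n → ℂ are conformal (injective holomorphic) maps converging locally uniformly on Ω to a function f. Then either f is constant, or f is a conformal map of Ω; and in the latter case the image domains G_n = f_n(Ω_n) converge to G = f(Ω) and f_n⁻¹ → f⁻¹ locally uniformly on G. -/
open Filter Topology Metric

lemma aux_nhds {U : Set ℂ} {f : ℂ → ℂ} (hU : IsOpen U) (hf : DifferentiableOn ℂ f U)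
    (hi : Set.InjOn f U) {z : ℂ} (hz : z ∈ U) : 𝓝 (f z) ≤ map f (𝓝 z) := by
  have ha : AnalyticAt ℂ f z := hf.analyticAt (hU.mem_nhds hz)
  rcases ha.eventually_constant_or_nhds_le_map_nhds with h | h
  · exfalso
    obtain ⟨ε, hε, hb⟩ := Metric.eventually_nhds_iff_ball.1 (h.and (hU.eventually_mem hz))
    have hm : z + (ε / 2 : ℝ) ∈ ball z ε := by
      simp [abs_of_pos hε]; linarith
    have h1 := hi (hb _ hm).2 hz (hb _ hm).1
    simp at h1
    exact hε.ne' h1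
  · exact h

lemma aux_open {U : Set ℂ} {f : ℂ → ℂ} (hU : IsOpen U) (hf : DifferentiableOn ℂ f U)
    (hi : Set.InjOn f U) : IsOpen (f '' U) := by
  rw [isOpen_iff_mem_nhds]
  rintro _ ⟨z, hz, rfl⟩
  exact aux_nhds hU hf hi hz (image_mem_map (hU.mem_nhds hz))

lemma aux_inv {U : Set ℂ} {f : ℂ → ℂ} (hi : Set.InjOn f U) {z : ℂ} (hz : z ∈ U) :
    Function.invFunOn f U (f z) = z := hi.leftInvOn_invFunOn hz

lemma aux_contAt {U : Set ℂ} {f : ℂ → ℂ} (hU : IsOpen U) (hf : DifferentiableOn ℂ f U)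
    (hi : Set.InjOn f U) {z : ℂ} (hz : z ∈ U) : ContinuousAt (Function.invFunOn f U) (f z) := by
  have h := map_mono (m := Function.invFunOn f U) (aux_nhds hU hf hi hz)
  rw [ContinuousAt, aux_inv hi hz, Tendsto]
  refine h.trans ?_
  rw [map_map]
  have : (Function.invFunOn f U ∘ f) =ᶠ[𝓝 z] id := by
    filter_upwards [hU.mem_nhds hz] with y hy using aux_inv hi hy
  rw [map_congr this, map_id]

lemma aux_hasDeriv {U : Set ℂ} {f : ℂ → ℂ} (hU : IsOpen U) (hf : DifferentiableOn ℂ f U)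
    (hi : Set.InjOn f U) {z : ℂ} (hz : z ∈ U) (hd : deriv f z ≠ 0) :
    HasDerivAt (Function.invFunOn f U) (deriv f z)⁻¹ (f z) := by
  refine HasDerivAt.of_local_left_inverse (f := f) (aux_contAt hU hf hi hz) ?_ hd ?_
  · rw [aux_inv hi hz]
    exact (hf.differentiableAt (hU.mem_nhds hz)).hasDerivAt
  · filter_upwards [(aux_open hU hf hi).mem_nhds (Set.mem_image_of_mem f hz)]
    rintro _ ⟨y, hy, rfl⟩
    rw [aux_inv hi hy]

lemma aux_deriv_ne {U : Set ℂ} {f : ℂ → ℂ} (hU : IsOpen U) (hf : DifferentiableOn ℂ f U)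
    (hi : Set.InjOn f U) {z : ℂ} (hz : z ∈ U) : deriv f z ≠ 0 := by
  have ha : AnalyticAt ℂ f z := hf.analyticAt (hU.mem_nhds hz)
  rcases ha.deriv.eventually_eq_zero_or_eventually_ne_zero with h | h
  · exfalso
    obtain ⟨ε, hε, hb⟩ := Metric.eventually_nhds_iff_ball.1 (h.and (hU.eventually_mem hz))
    have hm : z + (ε / 2 : ℝ) ∈ ball z ε := by
      simp [abs_of_pos hε]; linarith
    have hc := isOpen_ball.is_const_of_deriv_eq_zero (convex_ball z ε).isPreconnected
      (hf.mono fun y hy => (hb y hy).2) (fun y hy => (hb y hy).1) hm (mem_ball_self hε)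
    have h1 := hi (hb _ hm).2 hz hc
    simp at h1
    exact hε.ne' h1
  · rw [eventually_nhdsWithin_iff] at h
    obtain ⟨ε, hε, hb⟩ := Metric.eventually_nhds_iff_ball.1 (h.and (hU.eventually_mem hz))
    have hB : ball z ε ⊆ U := fun y hy => (hb y hy).2
    have hfB := hf.mono hB
    have hiB := hi.mono hB
    have hV := aux_open isOpen_ball hfB hiB
    have hzB := mem_ball_self (x := z) hε
    have hVz : f '' ball z ε ∈ 𝓝 (f z) := hV.mem_nhds (Set.mem_image_of_mem f hzB)
    have hD : DifferentiableOn ℂ (Function.invFunOn f (ball z ε)) (f '' ball z ε) := by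
      rw [← Complex.differentiableOn_compl_singleton_and_continuousAt_iff hVz]
      refine ⟨?_, aux_contAt isOpen_ball hfB hiB hzB⟩
      rintro _ ⟨⟨y, hy, rfl⟩, hne⟩
      have hyz : y ≠ z := fun h => hne (by simp [h])
      exact (aux_hasDeriv isOpen_ball hfB hiB hy
        ((hb y hy).1 hyz)).differentiableAt.differentiableWithinAt
    have h1 := (hD.differentiableAt hVz).hasDerivAt.comp z
      (hf.differentiableAt (hU.mem_nhds hz)).hasDerivAt
    have h2 : HasDerivAt (Function.invFunOn f (ball z ε) ∘ f) 1 z := by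
      refine (hasDerivAt_id z).congr_of_eventuallyEq ?_
      filter_upwards [isOpen_ball.mem_nhds hzB] with y hy using aux_inv hiB hy
    have h3 := h1.unique h2
    intro h0
    rw [h0, mul_zero] at h3
    exact zero_ne_one h3

lemma aux_sqrt {c : ℂ} {R : ℝ} (hR : 0 < R) {F : ℂ → ℂ} (hF : DifferentiableOn ℂ F (ball c R))
    (h0 : ∀ z ∈ ball c R, F z ≠ 0) :
    ∃ g : ℂ → ℂ, DifferentiableOn ℂ g (ball c R) ∧ ∀ z ∈ ball c R, g z ^ 2 = F z := by
  obtain ⟨L, hL⟩ := ((hF.deriv isOpen_ball).div hF h0).isExactOn_ball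
  have hFd : ∀ z ∈ ball c R, HasDerivAt F (deriv F z) z := fun z hz =>
    (hF.differentiableAt (isOpen_ball.mem_nhds hz)).hasDerivAt
  have hd : ∀ z ∈ ball c R, HasDerivAt (fun z => F z * Complex.exp (-L z)) 0 z := by
    intro z hz
    have h1 := (hFd z hz).mul (hL z hz).neg.cexp
    have e : deriv F z * Complex.exp ((-L) z) +
        F z * (Complex.exp ((-L) z) * -(deriv F / F) z) = 0 := by
      have := h0 z hz
      simp only [Pi.div_apply, Pi.neg_apply]
      field_simp
      ring
    rw [e] at h1
    exact h1
  have hc : ∀ z ∈ ball c R, F z * Complex.exp (-L z) = F c * Complex.exp (-L c) := fun z hz =>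
    isOpen_ball.is_const_of_deriv_eq_zero (convex_ball c R).isPreconnected
      (fun z hz => (hd z hz).differentiableAt.differentiableWithinAt)
      (fun z hz => (hd z hz).deriv) hz (mem_ball_self hR)
  obtain ⟨d, hdd⟩ := IsAlgClosed.exists_pow_nat_eq (F c * Complex.exp (-L c)) (n := 2) (by norm_num)
  refine ⟨fun z => d * Complex.exp (L z / 2), ?_, ?_⟩
  · intro z hz
    exact (((hL z hz).differentiableAt.div_const 2).cexp.const_mul d).differentiableWithinAt
  · intro z hz
    have e : Complex.exp (L z / 2) ^ 2 = Complex.exp (L z) := by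
      rw [← Complex.exp_nat_mul]; congr 1; push_cast; ring
    simp only [mul_pow, e, hdd, ← hc z hz]
    rw [mul_assoc, ← Complex.exp_add]; simp

lemma aux_koebe {c : ℂ} {R : ℝ} (hR : 0 < R) {f : ℂ → ℂ} (hf : DifferentiableOn ℂ f (ball c R))
    (hi : Set.InjOn f (ball c R)) : ball (f c) (R * ‖deriv f c‖ / 40) ⊆ f '' ball c R := by
  intro p hp
  by_contra hpn
  have hop := aux_open isOpen_ball hf hi
  have hcB := mem_ball_self (x := c) hR
  obtain ⟨a, haS, ha⟩ := hop.isClosed_compl.exists_infDist_eq_dist ⟨p, hpn⟩ (f c)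
  have hap : dist (f c) a < R * ‖deriv f c‖ / 40 := by
    rw [← ha]
    refine (infDist_le_dist_of_mem (show p ∈ (f '' ball c R)ᶜ from hpn)).trans_lt ?_
    rw [dist_comm]; exact hp
  have hsub : ball (f c) (dist (f c) a) ⊆ f '' ball c R := by
    intro y hy
    by_contra hyn
    have := infDist_le_dist_of_mem (x := f c) (show y ∈ (f '' ball c R)ᶜ from hyn)
    rw [ha, dist_comm _ y] at this
    exact absurd hy (by simpa using this)
  have h0 : ∀ z ∈ ball c R, f z - a ≠ 0 := fun z hz h =>
    haS ⟨z, hz, sub_eq_zero.1 h⟩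
  obtain ⟨g, hg, hg2⟩ := aux_sqrt hR (hf.sub_const a) h0
  have hg0 : ∀ z ∈ ball c R, g z ≠ 0 := fun z hz h => h0 z hz (by rw [← hg2 z hz, h]; simp)
  have hgi : ∀ x ∈ ball c R, ∀ y ∈ ball c R, g x ^ 2 = g y ^ 2 → x = y := by
    intro x hx y hy h
    rw [hg2 x hx, hg2 y hy] at h
    exact hi hx hy (sub_left_injective h)
  have hginj : Set.InjOn g (ball c R) := fun x hx y hy h => hgi x hx y hy (by rw [h])
  set b := g c with hb
  have hb0 : 0 < ‖b‖ := norm_pos_iff.2 (hg0 c hcB)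
  have hr : dist (f c) a = ‖b‖ ^ 2 := by
    rw [dist_eq_norm, ← hg2 c hcB, norm_pow]
  have hA := aux_open isOpen_ball hg hginj
  have hA' : IsOpen ((fun u => -u) ⁻¹' (g '' ball c R)) := hA.preimage continuous_neg
  have hdisj : Disjoint (g '' ball c R) ((fun u => -u) ⁻¹' (g '' ball c R)) := by
    rw [Set.disjoint_left]
    rintro _ ⟨x, hx, rfl⟩ ⟨y, hy, hxy⟩
    have := hgi y hy x hx (by rw [hxy]; ring)
    subst this
    simp only at hxy
    exact hg0 y hy (self_eq_neg.1 hxy)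
  have hT : ball b (2 / 5 * ‖b‖) ⊆ g '' ball c R := by
    refine IsPreconnected.subset_left_of_subset_union hA hA' hdisj ?_
      ⟨b, mem_ball_self (by positivity), c, hcB, rfl⟩ (convex_ball _ _).isPreconnected
    intro u hu
    rw [mem_ball, dist_eq_norm] at hu
    have h1 : ‖u + b‖ ≤ 12 / 5 * ‖b‖ := by
      have : u + b = (u - b) + 2 * b := by ring
      rw [this]
      refine (norm_add_le _ _).trans ?_
      rw [norm_mul]; norm_num; linarith
    have h2 : u ^ 2 + a ∈ ball (f c) (dist (f c) a) := by
      rw [mem_ball, hr, dist_eq_norm]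
      have : u ^ 2 + a - f c = (u - b) * (u + b) := by
        have := hg2 c hcB
        linear_combination this
      rw [this, norm_mul]
      nlinarith [norm_nonneg (u - b), norm_nonneg (u + b)]
    obtain ⟨z, hz, hzu⟩ := hsub h2
    have h3 : u ^ 2 = g z ^ 2 := by rw [hg2 z hz, hzu]; ring
    rcases sq_eq_sq_iff_eq_or_eq_neg.1 h3 with h | h
    · left; exact ⟨z, hz, h.symm⟩
    · right; exact ⟨z, hz, by simp [h]⟩
  have hlow : ∀ z ∈ ball c R, 2 / 5 * ‖b‖ ≤ ‖g z + b‖ := by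
    intro z hz
    by_contra hlt
    push Not at hlt
    have : -g z ∈ ball b (2 / 5 * ‖b‖) := by
      rw [mem_ball, dist_eq_norm, ← norm_neg]
      simpa [add_comm] using hlt
    exact Set.disjoint_left.1 hdisj (hT this) ⟨z, hz, by simp⟩
  have hne : ∀ z ∈ ball c R, g z + b ≠ 0 := fun z hz h => by
    have := hlow z hz
    rw [h, norm_zero] at this
    linarith
  have hG : DifferentiableOn ℂ (fun z => (g z + b)⁻¹) (ball c R) := (hg.add_const b).inv hne
  have hGb : ∀ z ∈ ball c R, ‖(g z + b)⁻¹‖ ≤ 5 / 2 / ‖b‖ := by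
    intro z hz
    rw [norm_inv]
    refine (inv_anti₀ (by positivity) (hlow z hz)).trans_eq ?_
    field_simp
  have hD := Complex.norm_deriv_le_div_of_mapsTo_ball (R₂ := 5 / ‖b‖) hG (by
    intro z hz
    rw [mem_closedBall, dist_eq_norm]
    refine (norm_sub_le _ _).trans ?_
    have := hGb z hz
    have := hGb c hcB
    have e : 5 / ‖b‖ = 5 / 2 / ‖b‖ + 5 / 2 / ‖b‖ := by ring
    linarith) hR
  have hgd : HasDerivAt g (deriv g c) c :=
    (hg.differentiableAt (isOpen_ball.mem_nhds hcB)).hasDerivAt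
  have hfd : HasDerivAt f (deriv f c) c :=
    (hf.differentiableAt (isOpen_ball.mem_nhds hcB)).hasDerivAt
  have e1 : deriv f c = 2 * b * deriv g c := by
    have h1 := hgd.pow 2
    have h2 : HasDerivAt (g ^ 2) (deriv f c) c := by
      refine (hfd.sub_const a).congr_of_eventuallyEq ?_
      filter_upwards [isOpen_ball.mem_nhds hcB] with z hz using hg2 z hz
    rw [h2.unique h1]; simp [hb]
  have e2 : deriv (fun z => (g z + b)⁻¹) c = -deriv g c / (2 * b) ^ 2 := by
    have := ((hgd.add_const b).inv (hne c hcB)).deriv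
    simp only [← hb, ← two_mul] at this
    exact this
  rw [e2, norm_div, norm_neg, norm_pow, norm_mul] at hD
  rw [hr, e1, norm_mul, norm_mul] at hap
  norm_num at hD hap
  rw [div_div, div_le_div_iff₀ (by positivity) (by positivity)] at hD
  have h5 : ‖deriv g c‖ * R ≤ 20 * ‖b‖ := by
    have : ‖b‖ * (‖deriv g c‖ * R) ≤ ‖b‖ * (20 * ‖b‖) := by nlinarith
    exact le_of_mul_le_mul_left this hb0
  nlinarith

lemma aux_koebe_inv {U : Set ℂ} {f : ℂ → ℂ} (hU : IsOpen U) (hf : DifferentiableOn ℂ f U)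
    (hi : Set.InjOn f U) {z : ℂ} (hz : z ∈ U) {R : ℝ} (hR : 0 < R)
    (hb : ball (f z) R ⊆ f '' U) : ball z (R / ‖deriv f z‖ / 40) ⊆ U := by
  set h := Function.invFunOn f U with hh
  have hd : DifferentiableOn ℂ h (ball (f z) R) := by
    intro w hw
    obtain ⟨y, hy, rfl⟩ := hb hw
    exact (aux_hasDeriv hU hf hi hy
      (aux_deriv_ne hU hf hi hy)).differentiableAt.differentiableWithinAt
  have hinj : Set.InjOn h (ball (f z) R) := by
    intro w hw w' hw' e
    obtain ⟨y, hy, rfl⟩ := hb hw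
    obtain ⟨y', hy', rfl⟩ := hb hw'
    rw [hh, aux_inv hi hy, aux_inv hi hy'] at e
    rw [e]
  have key := aux_koebe hR hd hinj
  rw [(aux_hasDeriv hU hf hi hz (aux_deriv_ne hU hf hi hz)).deriv, hh, aux_inv hi hz,
    norm_inv, ← div_eq_mul_inv] at key
  refine key.trans ?_
  rintro _ ⟨w, hw, rfl⟩
  obtain ⟨y, hy, rfl⟩ := hb hw
  rw [aux_inv hi hy]; exact hy

lemma aux_clopen {S T : Set ℂ} (hT : IsOpen T) (hS : IsPreconnected S) (hne : (S ∩ T).Nonempty)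
    (hfr : ∀ z ∈ S, z ∉ frontier T) : S ⊆ T := by
  refine hS.subset_left_of_subset_union hT isClosed_closure.isOpen_compl
    (Set.disjoint_left.2 fun x hx hx' => hx' (subset_closure hx)) ?_ hne
  intro z hz
  by_cases h : z ∈ closure T
  · left
    by_contra hn
    exact hfr z hz ⟨h, fun h' => hn (interior_subset h')⟩
  · right; exact h

lemma aux_loc {Ω : Set ℂ} {Ωn : ℕ → Set ℂ} (hΩo : IsOpen Ω) (hno : ∀ n, IsOpen (Ωn n))
    (hK : ∀ K : Set ℂ, K ⊆ Ω → IsCompact K → ∀ᶠ n in atTop, K ⊆ Ωn n)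
    {f : ℂ → ℂ} {fn : ℕ → ℂ → ℂ}
    (hfn : ∀ n, DifferentiableOn ℂ (fn n) (Ωn n) ∧ Set.InjOn (fn n) (Ωn n))
    (hconv : TendstoLocallyUniformlyOn fn f atTop Ω) (hfd : DifferentiableOn ℂ f Ω)
    {b : ℂ} (hb : b ∈ Ω) (hne : ∀ᶠ z in 𝓝[≠] b, f z ≠ f b) {ρ : ℝ} (hρ : 0 < ρ) :
    ∃ s > 0, ∀ᶠ n in atTop, ∀ w ∈ ball (f b) s, ∃ z ∈ Ωn n, dist z b < ρ ∧ fn n z = w := by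
  rw [eventually_nhdsWithin_iff] at hne
  obtain ⟨ε, hε, hB⟩ := Metric.eventually_nhds_iff_ball.1 (hne.and (hΩo.eventually_mem hb))
  set r := min ε ρ / 2 with hr
  have hm : 0 < min ε ρ := lt_min hε hρ
  have hr0 : 0 < r := by positivity
  have hrε : r < ε := by have := min_le_left ε ρ; linarith
  have hrρ : r < ρ := by have := min_le_right ε ρ; linarith
  have hcb : closedBall b r ⊆ Ω := fun y hy => (hB y (closedBall_subset_ball hrε hy)).2
  have hcs : sphere b r ⊆ closedBall b r := sphere_subset_closedBall
  obtain ⟨x, hx, hxm⟩ := (isCompact_sphere b r).exists_isMinOn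
    (NormedSpace.sphere_nonempty.2 hr0.le)
    (f := fun z => ‖f z - f b‖) ((hfd.continuousOn.mono (hcs.trans hcb)).sub continuousOn_const).norm
  set m := ‖f x - f b‖ with hmdef
  have hm0 : 0 < m := by
    refine norm_pos_iff.2 (sub_ne_zero.2 ((hB x (closedBall_subset_ball hrε (hcs hx))).1 ?_))
    rintro rfl
    simp at hx
    exact hr0.ne hx
  have hu := (tendstoLocallyUniformlyOn_iff_forall_isCompact hΩo).1 hconv _ hcb
    (isCompact_closedBall b r)
  rw [Metric.tendstoUniformlyOn_iff] at hu
  refine ⟨m / 8, by positivity, ?_⟩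
  filter_upwards [hu (m / 8) (by positivity), hK _ hcb (isCompact_closedBall b r)] with n h1 h2 w hw
  have hbc : b ∈ closedBall b r := mem_closedBall_self hr0.le
  have hdc : DiffContOnCl ℂ (fn n) (ball b r) := by
    refine DifferentiableOn.diffContOnCl ?_
    rw [closure_ball b hr0.ne']
    exact (hfn n).1.mono h2
  have hfb := h1 b hbc
  have hsub := hdc.ball_subset_image_closedBall (ε := m / 2) hr0 (by
    intro z hz
    have a1 : m ≤ ‖f z - f b‖ := hxm hz
    have a2 := h1 z (hcs hz)
    rw [← dist_eq_norm] at a1 ⊢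
    have := dist_triangle4 (f z) (fn n z) (fn n b) (f b)
    rw [dist_comm (fn n b)] at this
    linarith) (by
    have hf : ∃ᶠ z in 𝓝 b, z ≠ b :=
      ((eventually_mem_nhdsWithin (a := b) (s := {b}ᶜ)).frequently).filter_mono nhdsWithin_le_nhds
    refine (hf.and_eventually ((hno n).eventually_mem (h2 hbc))).mono ?_
    rintro z ⟨hz1, hz2⟩ he
    exact hz1 ((hfn n).2 hz2 (h2 hbc) he))
  have hw' : w ∈ ball (fn n b) (m / 2 / 2) := by
    rw [mem_ball] at hw ⊢
    have := dist_triangle w (f b) (fn n b)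
    linarith
  obtain ⟨z, hz, hzw⟩ := hsub hw'
  exact ⟨z, h2 hz, lt_of_le_of_lt hz hrρ, hzw⟩

lemma aux_limit {Ω : Set ℂ} {Ωn : ℕ → Set ℂ} (hΩo : IsOpen Ω)
    (hK : ∀ K : Set ℂ, K ⊆ Ω → IsCompact K → ∀ᶠ n in atTop, K ⊆ Ωn n)
    {f : ℂ → ℂ} {fn : ℕ → ℂ → ℂ}
    (hfn : ∀ n, DifferentiableOn ℂ (fn n) (Ωn n) ∧ Set.InjOn (fn n) (Ωn n))
    (hconv : TendstoLocallyUniformlyOn fn f atTop Ω) {b : ℂ} (hb : b ∈ Ω) :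
    DifferentiableAt ℂ f b ∧ Tendsto (fun n => deriv (fn n) b) atTop (𝓝 (deriv f b)) := by
  obtain ⟨r, hr, hrΩ⟩ := Metric.nhds_basis_closedBall.mem_iff.1 (hΩo.mem_nhds hb)
  have hbb : b ∈ ball b r := mem_ball_self hr
  have hc := hconv.mono (ball_subset_closedBall.trans hrΩ)
  have hd : ∀ᶠ n in atTop, DifferentiableOn ℂ (fn n) (ball b r) := by
    filter_upwards [hK _ hrΩ (isCompact_closedBall b r)] with n hn
    exact (hfn n).1.mono (ball_subset_closedBall.trans hn)
  exact ⟨(hc.differentiableOn hd isOpen_ball).differentiableAt (isOpen_ball.mem_nhds hbb),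
    (hc.deriv hd isOpen_ball).tendsto_at hbb⟩

theorem stmt19 (Ω : Set ℂ) (Ωn : ℕ → Set ℂ)
    (hΩo : IsOpen Ω) (hΩc : IsConnected Ω)
    (hno : ∀ n, IsOpen (Ωn n)) (hnc : ∀ n, IsConnected (Ωn n))
    (hmono : Monotone Ωn)
    (hK : ∀ K : Set ℂ, K ⊆ Ω → IsCompact K → ∀ᶠ n in atTop, K ⊆ Ωn n)
    (hbd : ∀ z ∈ frontier Ω, ∃ zn : ℕ → ℂ,
      (∀ n, zn n ∈ frontier (Ωn n)) ∧ Tendsto zn atTop (𝓝 z))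
    (f : ℂ → ℂ) (fn : ℕ → ℂ → ℂ)
    (hfn : ∀ n, DifferentiableOn ℂ (fn n) (Ωn n) ∧ Set.InjOn (fn n) (Ωn n))
    (hconv : TendstoLocallyUniformlyOn fn f atTop Ω) :
    (∃ c : ℂ, ∀ z ∈ Ω, f z = c) ∨
      (DifferentiableOn ℂ f Ω ∧ Set.InjOn f Ω ∧
        (∀ K : Set ℂ, K ⊆ f '' Ω → IsCompact K → ∀ᶠ n in atTop, K ⊆ fn n '' Ωn n) ∧
        (∀ w ∈ frontier (f '' Ω), ∃ wn : ℕ → ℂ,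
          (∀ n, wn n ∈ frontier (fn n '' Ωn n)) ∧ Tendsto wn atTop (𝓝 w)) ∧
        TendstoLocallyUniformlyOn (fun n => Function.invFunOn (fn n) (Ωn n))
          (Function.invFunOn f Ω) atTop (f '' Ω)) := by
  by_cases hconst : ∃ c : ℂ, ∀ z ∈ Ω, f z = c
  · exact Or.inl hconst
  right
  have hfd : DifferentiableOn ℂ f Ω := fun z hz =>
    (aux_limit hΩo hK hfn hconv hz).1.differentiableWithinAt
  have hne : ∀ b ∈ Ω, ∀ᶠ z in 𝓝[≠] b, f z ≠ f b := by
    intro b hb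
    have han : AnalyticOnNhd ℂ f Ω := hfd.analyticOnNhd hΩo
    rcases (han b hb).eventually_eq_or_eventually_ne (analyticAt_const (v := f b)) with h | h
    · exact absurd ⟨f b, han.eqOn_of_preconnected_of_eventuallyEq analyticOnNhd_const
        hΩc.isPreconnected hb h⟩ hconst
    · exact h
  have loc : ∀ b ∈ Ω, ∀ ρ > 0, ∃ s > 0, ∀ᶠ n in atTop, ∀ w ∈ ball (f b) s,
      ∃ z ∈ Ωn n, dist z b < ρ ∧ fn n z = w := fun b hb ρ hρ =>
    aux_loc hΩo hno hK hfn hconv hfd hb (hne b hb) hρ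
  have hinj : Set.InjOn f Ω := by
    intro a ha b hb hab
    by_contra hne'
    have hd : 0 < dist a b := dist_pos.2 hne'
    obtain ⟨s, hs, h1⟩ := loc a ha (dist a b / 2) (by positivity)
    obtain ⟨t, ht, h2⟩ := loc b hb (dist a b / 2) (by positivity)
    obtain ⟨n, h1, h2⟩ := (h1.and h2).exists
    obtain ⟨z, hz, hza, hzf⟩ := h1 (f a) (mem_ball_self hs)
    obtain ⟨y, hy, hyb, hyf⟩ := h2 (f b) (mem_ball_self ht)
    have : z = y := (hfn n).2 hz hy (by rw [hzf, hyf, hab])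
    subst this
    have := dist_triangle_left a b z
    linarith
  have hG : ∀ K : Set ℂ, K ⊆ f '' Ω → IsCompact K → ∀ᶠ n in atTop, K ⊆ fn n '' Ωn n := by
    intro K hKG hKc
    refine hKc.induction_on (p := fun S => ∀ᶠ n in atTop, S ⊆ fn n '' Ωn n) (by simp)
      (fun s t hst h => h.mono fun n hn => hst.trans hn)
      (fun s t h1 h2 => (h1.and h2).mono fun n hn => Set.union_subset hn.1 hn.2) ?_
    intro w hw
    obtain ⟨b, hb, rfl⟩ := hKG hw
    obtain ⟨s, hs, h⟩ := loc b hb 1 one_pos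
    refine ⟨ball (f b) s, mem_nhdsWithin_of_mem_nhds (ball_mem_nhds _ hs), ?_⟩
    filter_upwards [h] with n hn w hw
    obtain ⟨z, hz, -, hzw⟩ := hn w hw
    exact ⟨z, hz, hzw⟩
  have hGo : IsOpen (f '' Ω) := aux_open hΩo hfd hinj
  have hGno : ∀ n, IsOpen (fn n '' Ωn n) := fun n => aux_open (hno n) (hfn n).1 (hfn n).2
  refine ⟨hfd, hinj, hG, ?_, ?_⟩
  · intro w hw
    have hwG : w ∉ f '' Ω := fun h => by
      rw [hGo.frontier_eq] at hw
      exact hw.2 h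
    have hFne : ∀ n, (frontier (fn n '' Ωn n)).Nonempty := by
      intro n
      by_contra hemp
      rw [Set.not_nonempty_iff_eq_empty] at hemp
      obtain ⟨z0, hz0⟩ := (hnc n).nonempty
      have hun : fn n '' Ωn n = Set.univ := Set.univ_subset_iff.1 <|
        aux_clopen (hGno n) isPreconnected_univ ⟨fn n z0, trivial, z0, hz0, rfl⟩
          (by simp [hemp])
      have hd0 := norm_pos_iff.2 (aux_deriv_ne (hno n) (hfn n).1 (hfn n).2 hz0)
      have hΩn : Ωn n = Set.univ := by
        rw [Set.eq_univ_iff_forall]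
        intro y
        have hR : 0 < (dist y z0 + 1) * 40 * ‖deriv (fn n) z0‖ := by positivity
        refine aux_koebe_inv (hno n) (hfn n).1 (hfn n).2 hz0 hR (by simp [hun]) ?_
        rw [mem_ball]
        field_simp
        linarith
      obtain ⟨a, ha⟩ := hΩc.nonempty
      have hΩ : Ω = Set.univ := Set.univ_subset_iff.1 <|
        aux_clopen hΩo isPreconnected_univ ⟨a, trivial, ha⟩ (by
          intro z _ hz
          obtain ⟨zn, h1, -⟩ := hbd z hz
          have := h1 n
          rw [hΩn] at this
          simp at this)
      have hda := norm_pos_iff.2 (aux_deriv_ne hΩo hfd hinj ha)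
      have hR : 0 < (dist w (f a) + 1) * 40 / ‖deriv f a‖ := by positivity
      have hsub : ball a ((dist w (f a) + 1) * 40 / ‖deriv f a‖) ⊆ Ω := by simp [hΩ]
      refine hwG (Set.image_mono hsub (aux_koebe hR (hfd.mono hsub) (hinj.mono hsub) ?_))
      rw [mem_ball]
      field_simp
      linarith
    have hclose : ∀ ε > 0, ∀ᶠ n in atTop, ∃ y ∈ frontier (fn n '' Ωn n), dist w y < ε := by
      intro ε hε
      by_contra hcon
      rw [not_eventually] at hcon
      obtain ⟨w', ⟨z', hz', rfl⟩, hw'⟩ :=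
        Metric.mem_closure_iff.1 hw.1 (ε / 100000) (by positivity)
      have hd0 := norm_pos_iff.2 (aux_deriv_ne hΩo hfd hinj hz')
      have hlim := (aux_limit hΩo hK hfn hconv hz').2.norm
      have hev1 : ∀ᶠ n in atTop, ‖deriv (fn n) z'‖ < 2 * ‖deriv f z'‖ :=
        hlim.eventually_lt_const (by linarith)
      have hev2 : ∀ᶠ n in atTop, dist (fn n z') (f z') < ε / 4 :=
        (hconv.tendsto_at hz').eventually (ball_mem_nhds _ (by positivity))
      have hev3 : ∀ᶠ n in atTop, z' ∈ Ωn n := by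
        filter_upwards [hK {z'} (by simpa using hz') isCompact_singleton] with n hn
        exact hn rfl
      have hfreq : ∃ᶠ n in atTop, ball z' (ε / 160 / ‖deriv f z'‖) ⊆ Ωn n := by
        refine (hcon.and_eventually (hev1.and (hev2.and hev3))).mono ?_
        rintro n ⟨h0, h1, h2, h3⟩
        push Not at h0
        have hsub : ball w ε ⊆ fn n '' Ωn n := by
          refine aux_clopen (hGno n) (convex_ball w ε).isPreconnected
            ⟨fn n z', ?_, z', h3, rfl⟩ ?_
          · rw [mem_ball]
            have := dist_triangle_right (fn n z') w (f z')
            linarith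
          · intro z hz hzf
            have := h0 z hzf
            rw [mem_ball, dist_comm] at hz
            linarith
        have hsub2 : ball (fn n z') (ε / 2) ⊆ fn n '' Ωn n := by
          refine (ball_subset_ball' ?_).trans hsub
          have := dist_triangle_right (fn n z') w (f z')
          linarith
        refine (ball_subset_ball ?_).trans
          (aux_koebe_inv (hno n) (hfn n).1 (hfn n).2 h3 (by positivity) hsub2)
        have hdn := norm_pos_iff.2 (aux_deriv_ne (hno n) (hfn n).1 (hfn n).2 h3)
        rw [div_div, div_div, div_div, div_le_div_iff₀ (by positivity) (by positivity)]
        nlinarith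
      have hr0 : 0 < ε / 160 / ‖deriv f z'‖ := by positivity
      have hD : ball z' (ε / 160 / ‖deriv f z'‖) ⊆ Ω := by
        refine aux_clopen hΩo (convex_ball _ _).isPreconnected ⟨z', mem_ball_self hr0, hz'⟩ ?_
        intro z hz hzf
        obtain ⟨zn, h1, h2⟩ := hbd z hzf
        obtain ⟨n, h3, h4⟩ := (hfreq.and_eventually (h2.eventually (isOpen_ball.mem_nhds hz))).exists
        have := h1 n
        rw [(hno n).frontier_eq] at this
        exact this.2 (h3 h4)
      refine hwG (Set.image_mono hD (aux_koebe hr0 (hfd.mono hD) (hinj.mono hD) ?_))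
      rw [mem_ball, div_mul_cancel₀ _ hd0.ne']
      linarith
    choose wn hwn hwd using fun n => (isClosed_frontier (s := fn n '' Ωn n)).exists_infDist_eq_dist
      (hFne n) w
    refine ⟨wn, hwn, ?_⟩
    rw [Metric.tendsto_nhds]
    intro ε hε
    filter_upwards [hclose ε hε] with n hn
    obtain ⟨y, hy, hyd⟩ := hn
    rw [dist_comm, ← hwd n]
    exact (infDist_le_dist_of_mem hy).trans_lt hyd
  · rw [Metric.tendstoLocallyUniformlyOn_iff]
    rintro ε hε _ ⟨b, hb, rfl⟩
    obtain ⟨s, hs, h⟩ := loc b hb (ε / 2) (by positivity)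
    have hc := (aux_contAt hΩo hfd hinj hb).eventually
      (ball_mem_nhds _ (show 0 < ε / 2 by positivity))
    refine ⟨_, mem_nhdsWithin_of_mem_nhds (inter_mem (ball_mem_nhds (f b) hs) hc), ?_⟩
    filter_upwards [h] with n hn w hw
    obtain ⟨z, hz, hzb, rfl⟩ := hn w hw.1
    have h2 : dist (Function.invFunOn f Ω (fn n z)) (Function.invFunOn f Ω (f b)) < ε / 2 := hw.2
    rw [aux_inv hinj hb] at h2
    simp only [aux_inv (hfn n).2 hz]
    have := dist_triangle_right (Function.invFunOn f Ω (fn n z)) z b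
    linarith
end
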